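/- arXiv:2512.21112 — 5 statements merged into one kernel-verified Lean document; each statement's English description precedes it below -/
import Mathlib

section
/- Let X be a hyperconfusion over a finite probability space (Ω, p). Let C ⊆ ℝ^Ω be the convex hull of the indicator vectors 1_A for A ∈ X (where 1_A(ω) = 1 if ω ∈ A and 0 otherwise). Then H(X) = min_{v ∈ C} Σ_{ω∈Ω} p(ω) · log₂(1/v(ω)), with the conventions 0·log₂(1/0) = 0 and p(ω)·log₂(1/0) = ∞ when p(ω) > 0. -/
open Finset
open scoped Classical ENNReal

noncomputable section

variable {Ω : Type*}

/-- `X` is a confusion hypergraph (hyperconfusion) over `Ω`: a nonempty,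
downward-closed family of subsets of `Ω`. -/
def IsHyp (X : Finset (Finset Ω)) : Prop :=
  X.Nonempty ∧ ∀ A ∈ X, ∀ B ⊆ A, B ∈ X

/-- `p` is a probability mass function on the finite type `Ω`. -/
def IsPMF [Fintype Ω] (p : Ω → ℝ) : Prop :=
  (∀ ω, 0 ≤ p ω) ∧ ∑ ω : Ω, p ω = 1

/-- The probability of a set `A` under the pmf `p`. -/
def pset (p : Ω → ℝ) (A : Finset Ω) : ℝ := ∑ ω ∈ A, p ω

/-- A valid conditional pmf `k` from `Ω` to (pmfs on) `X`: nonnegative, sums to one,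
supported on `X`, and `k A z > 0` with `p z > 0` implies `z ∈ A`. -/
def ValidK [Fintype Ω] (p : Ω → ℝ) (X : Finset (Finset Ω)) (k : Ω → Finset Ω → ℝ) : Prop :=
  (∀ z A, 0 ≤ k z A) ∧ (∀ z, ∑ A : Finset Ω, k z A = 1) ∧
    (∀ z A, 0 < k z A → A ∈ X) ∧ ∀ z A, 0 < p z → 0 < k z A → z ∈ A

/-- The mutual information `I(Z;A)` where `Z ∼ p` and `A | Z ∼ k`. -/
def MI [Fintype Ω] (p : Ω → ℝ) (k : Ω → Finset Ω → ℝ) : ℝ :=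
  ∑ z : Ω, ∑ A : Finset Ω,
    p z * k z A * Real.logb 2 (k z A / ∑ z' : Ω, p z' * k z' A)

/-- The entropy `H(X)` of a hyperconfusion `X` over `(Ω, p)`, valued in `[0,∞]`
(`∞` when no valid conditional pmf exists). -/
def Hent [Fintype Ω] (p : Ω → ℝ) (X : Finset (Finset Ω)) : ℝ≥0∞ :=
  ⨅ (k : Ω → Finset Ω → ℝ) (_ : ValidK p X k), ENNReal.ofReal (MI p k)

/-- `−log₂ x = log₂ (1/x)`, valued in `[0,∞]` (equals `∞` when `x ≤ 0`). -/
def negLog2 (x : ℝ) : ℝ≥0∞ :=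
  if x ≤ 0 then ⊤ else ENNReal.ofReal (Real.logb 2 x⁻¹)

/-- The min-entropy `H∞(X) = −log₂ max_{A ∈ X} p(A)`. -/
def Hmin [Fintype Ω] (p : Ω → ℝ) (X : Finset (Finset Ω)) : ℝ≥0∞ :=
  ⨅ A ∈ X, negLog2 (pset p A)

/-- The integral max-entropy `H₀(X)`: `log₂` of the minimum cardinality of a subfamily
of `X` covering `supp(p)` (`∞` if there is none). -/
def H0ent [Fintype Ω] (p : Ω → ℝ) (X : Finset (Finset Ω)) : ℝ≥0∞ :=
  ⨅ (S : Finset (Finset Ω))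
    (_ : S ⊆ X ∧ ∀ ω : Ω, 0 < p ω → ∃ A ∈ S, ω ∈ A),
    ENNReal.ofReal (Real.logb 2 (S.card : ℝ))

/-- The fractional max-entropy `Hε(X)`: `log₂` of the minimum total weight of a
fractional covering of `supp(p)` by members of `X` (`∞` if there is none). -/
def Heps [Fintype Ω] (p : Ω → ℝ) (X : Finset (Finset Ω)) : ℝ≥0∞ :=
  ⨅ (μ : Finset Ω → ℝ)
    (_ : (∀ A, 0 ≤ μ A) ∧ (∀ A, μ A ≠ 0 → A ∈ X) ∧
      ∀ ω : Ω, 0 < p ω → 1 ≤ ∑ A ∈ X, if ω ∈ A then μ A else 0),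
    ENNReal.ofReal (Real.logb 2 (∑ A ∈ X, μ A))

/-- The support of the pmf `p`. -/
def suppP [Fintype Ω] (p : Ω → ℝ) : Finset Ω := univ.filter fun ω => 0 < p ω

/-- The support of a hyperconfusion: the points whose singleton is confusable. -/
def suppH [Fintype Ω] (X : Finset (Finset Ω)) : Finset Ω :=
  univ.filter fun ω => ({ω} : Finset Ω) ∈ X

/-- `X` is an ordinary information: the union of the powersets of a nonempty collection
of pairwise disjoint subsets of `Ω`. -/
def IsOI (X : Finset (Finset Ω)) : Prop :=
  ∃ S : Finset (Finset Ω), S.Nonempty ∧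
    (∀ A ∈ S, ∀ B ∈ S, A ≠ B → Disjoint A B) ∧
    ∀ C : Finset Ω, C ∈ X ↔ ∃ A ∈ S, C ⊆ A

/-- The Heyting implication `X → Y := {A ⊆ Ω : X ∩ 2^A ⊆ Y}` of hyperconfusions. -/
def himpHyp [Fintype Ω] (X Y : Finset (Finset Ω)) : Finset (Finset Ω) :=
  univ.filter fun A => ∀ B ∈ X, B ⊆ A → B ∈ Y

/-- `log₂` on `[0,∞]`. -/
def elog2 (x : ℝ≥0∞) : ℝ≥0∞ :=
  if x = ⊤ then ⊤ else ENNReal.ofReal (Real.logb 2 x.toReal)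

/-- The maximal members of a hyperconfusion (under inclusion). -/
def maxsHyp (X : Finset (Finset Ω)) : Finset (Finset Ω) :=
  X.filter fun A => ∀ B ∈ X, A ⊆ B → B = A

/-- The indicator vector of `A ⊆ Ω`, as an element of `ℝ^Ω`. -/
def indVec (A : Finset Ω) : Ω → ℝ := fun ω => if ω ∈ A then 1 else 0

/-- The ordinary information `oi(f) = {A : |f(A)| ≤ 1}` induced by a function `f`. -/
def oiF {Ω' : Type*} [Fintype Ω] (f : Ω → Ω') : Finset (Finset Ω) :=
  univ.filter fun A : Finset Ω => (A.image f).card ≤ 1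

/-- Independence of two hyperconfusions: all unions of maximal confusable sets are
independent events. -/
def IndepHyp [Fintype Ω] (p : Ω → ℝ) (X Y : Finset (Finset Ω)) : Prop :=
  ∀ S ⊆ maxsHyp X, ∀ T ⊆ maxsHyp Y,
    pset p ((S.biUnion id) ∩ (T.biUnion id)) =
      pset p (S.biUnion id) * pset p (T.biUnion id)

/-- The embedding `Xᵢ` of a hyperconfusion `X` over `Ω` into the product space `Ωⁿ`
along coordinate `i`. -/
def embedHyp [Fintype Ω] (X : Finset (Finset Ω)) (n : ℕ) (i : Fin n) :
    Finset (Finset (Fin n → Ω)) :=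
  univ.filter fun C => ∃ A ∈ X, ∀ ω ∈ C, ω i ∈ A

/-- The i.i.d. product pmf `p^⊗ⁿ` on `Ωⁿ`. -/
def pPow [Fintype Ω] (p : Ω → ℝ) (n : ℕ) : (Fin n → Ω) → ℝ :=
  fun ω => ∏ i, p (ω i)

/-- The conditional pmf `p(·|E)` (supported on `E`). -/
def condP [Fintype Ω] (p : Ω → ℝ) (E : Finset Ω) : Ω → ℝ :=
  fun ω => if ω ∈ E then p ω / pset p E else 0

/-- The conditional entropy `H(X|E)` of the hyperconfusion `X ∩ 2^E` over the
conditional probability space `(E, p(·|E))`. -/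
def HcondEvent [Fintype Ω] (p : Ω → ℝ) (X : Finset (Finset Ω)) (E : Finset Ω) : ℝ≥0∞ :=
  Hent (condP p E) (X ∩ E.powerset)

/-- The conditional entropy `H(X|Y) := p(E)·(H(X∩Y|E) − H(Y|E))` where `E = supp(Y)`,
taken to be `0` when `p(E) = 0`. -/
def Hcond [Fintype Ω] (p : Ω → ℝ) (X Y : Finset (Finset Ω)) : ℝ≥0∞ :=
  if pset p (suppH Y) = 0 then 0
  else ENNReal.ofReal (pset p (suppH Y)) *
    (HcondEvent p (X ∩ Y) (suppH Y) - HcondEvent p Y (suppH Y))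

/-- The singleton hyperconfusion `sing(Ω) = {∅} ∪ {{ω} : ω ∈ Ω}`. -/
def singHyp (α : Type*) [Fintype α] : Finset (Finset α) :=
  insert ∅ (univ.image fun ω : α => ({ω} : Finset α))

/-- A valid pmf `q` on `Ỹ` for the coarse entropy: supported on `Yt`, and dominating `p`
in the sense that `p(S) ≤ Σ_{B ∈ Yt, S∩B ≠ ∅} q(B)` for all `S`. -/
def ValidQ [Fintype Ω] (p : Ω → ℝ) (Yt : Finset (Finset Ω)) (q : Finset Ω → ℝ) : Prop :=
  (∀ B, 0 ≤ q B) ∧ (∀ B, q B ≠ 0 → B ∈ Yt) ∧ (∑ B : Finset Ω, q B = 1) ∧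
    ∀ S : Finset Ω, pset p S ≤ ∑ B ∈ Yt, if (S ∩ B).Nonempty then q B else 0

/-- A valid conditional pmf `m` from `Ỹ` to `X` for the coarse entropy:
`m A B > 0` with `q B > 0` implies `B ⊆ A`. -/
def ValidM [Fintype Ω] (X : Finset (Finset Ω)) (q : Finset Ω → ℝ)
    (m : Finset Ω → Finset Ω → ℝ) : Prop :=
  (∀ B A, 0 ≤ m B A) ∧ (∀ B, ∑ A : Finset Ω, m B A = 1) ∧
    (∀ B A, 0 < m B A → A ∈ X) ∧ ∀ B A, 0 < q B → 0 < m B A → B ⊆ A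

/-- The mutual information `I(B;A)` where `B ∼ q` and `A | B ∼ m`. -/
def MI2 [Fintype Ω] (q : Finset Ω → ℝ) (m : Finset Ω → Finset Ω → ℝ) : ℝ :=
  ∑ B : Finset Ω, ∑ A : Finset Ω,
    q B * m B A * Real.logb 2 (m B A / ∑ B' : Finset Ω, q B' * m B' A)

/-- The coarse entropy `H(X ↘ Y)` of `X` with respect to `Y`. -/
def Hcoarse [Fintype Ω] (p : Ω → ℝ) (X Y : Finset (Finset Ω)) : ℝ≥0∞ :=
  if Y ∪ singHyp Ω ⊆ X then
    ⨆ (q : Finset Ω → ℝ) (_ : ValidQ p (Y ∪ singHyp Ω) q),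
      ⨅ (m : Finset Ω → Finset Ω → ℝ) (_ : ValidM X q m), ENNReal.ofReal (MI2 q m)
  else ⊤

/-- The capacity `C(X) = max_p H(X)` of a hyperconfusion. -/
def capacity [Fintype Ω] (X : Finset (Finset Ω)) : ℝ≥0∞ :=
  ⨆ (p : Ω → ℝ) (_ : IsPMF p), Hent p X

/-- The product hyperconfusion `X ⊗ Y` over `Ω × Γ`. -/
def prodHyp {Γ : Type*} [Fintype Ω] [Fintype Γ]
    (X : Finset (Finset Ω)) (Y : Finset (Finset Γ)) : Finset (Finset (Ω × Γ)) :=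
  univ.filter fun C => ∃ A ∈ X, ∃ B ∈ Y, ∀ c ∈ C, c.1 ∈ A ∧ c.2 ∈ B

/-- The `n`-fold product hyperconfusion `X^⊗ⁿ` over `Ωⁿ`. -/
def powHyp [Fintype Ω] (X : Finset (Finset Ω)) (n : ℕ) : Finset (Finset (Fin n → Ω)) :=
  univ.filter fun C => ∃ A : Fin n → Finset Ω, (∀ i, A i ∈ X) ∧ ∀ ω ∈ C, ∀ i, ω i ∈ A i

/-- `X ⊑ Y`: there is a surjective hyperconfusable set-valued function from `(Ω,X)`
to `(Γ,Y)`. -/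
def ConfusesOnto {Γ : Type*} [Fintype Ω] [Fintype Γ]
    (X : Finset (Finset Ω)) (Y : Finset (Finset Γ)) : Prop :=
  ∃ β : Ω → Finset Γ, (∀ A ∈ X, A.biUnion β ∈ Y) ∧ univ.biUnion β = univ

/-- The confusion ratio `CR(X/Y) = sup{m/n : X^⊗ⁿ ⊑ Y^⊗ᵐ}`. -/
def confRatio {Γ : Type*} [Fintype Ω] [Fintype Γ]
    (X : Finset (Finset Ω)) (Y : Finset (Finset Γ)) : ℝ≥0∞ :=
  ⨆ (n : ℕ) (m : ℕ)
    (_ : 0 < n ∧ 0 < m ∧ ConfusesOnto (powHyp X n) (powHyp Y m)),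
    (m : ℝ≥0∞) / (n : ℝ≥0∞)

lemma aux_gibbs {ι : Type*} (s : Finset ι) (a b : ι → ℝ) (ha : ∀ i, 0 ≤ a i) (hb : ∀ i, 0 ≤ b i)
    (hab : ∀ i, 0 < a i → 0 < b i) (h : ∑ i ∈ s, b i ≤ ∑ i ∈ s, a i) :
    0 ≤ ∑ i ∈ s, a i * Real.logb 2 (a i / b i) := by
  have h2 : 0 < Real.log 2 := Real.log_pos (by norm_num)
  have key : ∀ i ∈ s, (a i - b i) / Real.log 2 ≤ a i * Real.logb 2 (a i / b i) := by
    intro i _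
    unfold Real.logb
    rw [← mul_div_assoc]
    apply div_le_div_of_nonneg_right _ h2.le
    rcases (ha i).eq_or_lt with h0 | h0
    · rw [← h0]; simpa using hb i
    · have hbi := hab i h0
      have h3 := Real.one_sub_inv_le_log_of_pos (div_pos h0 hbi)
      have h4 := mul_le_mul_of_nonneg_left h3 h0.le
      have h5 : a i * (1 - (a i / b i)⁻¹) = a i - b i := by field_simp
      linarith
  refine le_trans ?_ (Finset.sum_le_sum key)
  rw [← Finset.sum_div, Finset.sum_sub_distrib]
  exact div_nonneg (by linarith) h2.le

lemma aux_hull [Fintype Ω] (X : Finset (Finset Ω)) (v : Ω → ℝ) :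
    v ∈ convexHull ℝ (indVec '' (X : Set (Finset Ω))) ↔
      ∃ w : Finset Ω → ℝ, (∀ A, 0 ≤ w A) ∧ (∀ A, 0 < w A → A ∈ X) ∧ ∑ A : Finset Ω, w A = 1 ∧
        ∀ ω, v ω = ∑ A : Finset Ω, w A * indVec A ω := by
  constructor
  · intro hv
    refine convexHull_min (t := {v | ∃ w : Finset Ω → ℝ, (∀ A, 0 ≤ w A) ∧
      (∀ A, 0 < w A → A ∈ X) ∧ ∑ A : Finset Ω, w A = 1 ∧
        ∀ ω, v ω = ∑ A : Finset Ω, w A * indVec A ω}) ?_ ?_ hv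
    · rintro _ ⟨A, hA, rfl⟩
      refine ⟨fun B => if B = A then 1 else 0, ?_, ?_, ?_, ?_⟩
      · intro B; dsimp only; split_ifs <;> norm_num
      · intro B hB
        by_cases h : B = A
        · rw [h]; exact hA
        · simp [h] at hB
      · simp
      · intro ω; simp
    · rintro v ⟨w, h1, h2, h3, h4⟩ v' ⟨w', h1', h2', h3', h4'⟩ a b ha hb hab
      refine ⟨fun A => a * w A + b * w' A, ?_, ?_, ?_, ?_⟩
      · intro A
        have := mul_nonneg ha (h1 A)
        have := mul_nonneg hb (h1' A)
        dsimp only; linarith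
      · intro A hA
        by_contra hn
        have e1 : w A = 0 := le_antisymm (not_lt.1 fun h => hn (h2 A h)) (h1 A)
        have e2 : w' A = 0 := le_antisymm (not_lt.1 fun h => hn (h2' A h)) (h1' A)
        simp [e1, e2] at hA
      · rw [Finset.sum_add_distrib, ← Finset.mul_sum, ← Finset.mul_sum, h3, h3']; linarith
      · intro ω
        simp only [Pi.add_apply, Pi.smul_apply, smul_eq_mul, h4, h4', Finset.mul_sum,
          ← Finset.sum_add_distrib]
        exact Finset.sum_congr rfl fun A _ => by ring
  · rintro ⟨w, h1, h2, h3, h4⟩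
    have hz : ∀ A, A ∉ X → w A = 0 := fun A hn =>
      le_antisymm (not_lt.1 fun h => hn (h2 A h)) (h1 A)
    have e : v = ∑ A ∈ X, w A • (indVec A : Ω → ℝ) := by
      funext ω
      rw [h4, Finset.sum_apply]
      symm
      refine Finset.sum_subset (Finset.subset_univ X) fun A _ hA => ?_
      simp [hz A hA]
    rw [e]
    refine (convex_convexHull ℝ _).sum_mem (fun A _ => h1 A) ?_
      (fun A hA => subset_convexHull ℝ _ ⟨A, hA, rfl⟩)
    rw [← h3]
    exact Finset.sum_subset (Finset.subset_univ X) fun A _ hA => hz A hA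

lemma aux_sum [Fintype Ω] (p v : Ω → ℝ) (hp : ∀ ω, 0 ≤ p ω) (hv : ∀ ω, 0 < p ω → 0 < v ω)
    (hv1 : ∀ ω, v ω ≤ 1) :
    ∑ ω : Ω, ENNReal.ofReal (p ω) * negLog2 (v ω) =
      ENNReal.ofReal (∑ ω, p ω * Real.logb 2 (v ω)⁻¹) := by
  have hnn : ∀ ω, 0 < p ω → 0 ≤ Real.logb 2 (v ω)⁻¹ := fun ω h =>
    Real.logb_nonneg (by norm_num) ((one_le_inv₀ (hv ω h)).2 (hv1 ω))
  rw [ENNReal.ofReal_sum_of_nonneg]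
  · refine Finset.sum_congr rfl fun ω _ => ?_
    rcases (hp ω).eq_or_lt with h | h
    · simp [← h]
    · rw [negLog2, if_neg (not_le.2 (hv ω h)), ENNReal.ofReal_mul (hp ω)]
  · intro ω _
    rcases (hp ω).eq_or_lt with h | h
    · simp [← h]
    · exact mul_nonneg (hp ω) (hnn ω h)

lemma aux_le_one [Fintype Ω] (w : Finset Ω → ℝ) (h1 : ∀ A, 0 ≤ w A)
    (h3 : ∑ A : Finset Ω, w A = 1) (ω : Ω) : ∑ A : Finset Ω, w A * indVec A ω ≤ 1 := by
  rw [← h3]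
  refine Finset.sum_le_sum fun A _ => ?_
  have := h1 A
  unfold indVec
  split_ifs <;> linarith

lemma aux_le [Fintype Ω] (p : Ω → ℝ) (hp : IsPMF p) (X : Finset (Finset Ω)) (w : Finset Ω → ℝ)
    (v : Ω → ℝ)
    (h1 : ∀ A, 0 ≤ w A) (h2 : ∀ A, 0 < w A → A ∈ X) (h3 : ∑ A : Finset Ω, w A = 1)
    (h4 : ∀ ω, v ω = ∑ A : Finset Ω, w A * indVec A ω) (hv : ∀ ω, 0 < p ω → 0 < v ω) :
    ∃ k, ValidK p X k ∧ MI p k ≤ ∑ ω, p ω * Real.logb 2 (v ω)⁻¹ := by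
  have hi : ∀ (A : Finset Ω) ω, 0 ≤ indVec A ω := fun A ω => by
    unfold indVec; split_ifs <;> norm_num
  let k : Ω → Finset Ω → ℝ := fun z A => if 0 < p z then w A * indVec A z / v z else w A
  have kpos : ∀ z, 0 < p z → ∀ A, k z A = w A * indVec A z / v z := fun z hz A => if_pos hz
  have kneg : ∀ z, ¬ 0 < p z → ∀ A, k z A = w A := fun z hz A => if_neg hz
  have k0 : ∀ z A, 0 ≤ k z A := by
    intro z A
    by_cases hz : 0 < p z
    · rw [kpos z hz]; exact div_nonneg (mul_nonneg (h1 A) (hi A z)) (hv z hz).le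
    · rw [kneg z hz]; exact h1 A
  have k1 : ∀ z, ∑ A : Finset Ω, k z A = 1 := by
    intro z
    by_cases hz : 0 < p z
    · simp only [kpos z hz]
      rw [← Finset.sum_div, ← h4, div_self (hv z hz).ne']
    · simp only [kneg z hz]; exact h3
  have kw : ∀ z A, 0 < k z A → 0 < w A := by
    intro z A hk
    refine (h1 A).lt_of_ne fun h => ?_
    by_cases hz : 0 < p z
    · rw [kpos z hz, ← h] at hk; simp at hk
    · rw [kneg z hz, ← h] at hk; simp at hk
  have kmem : ∀ z A, 0 < p z → 0 < k z A → z ∈ A := by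
    intro z A hz hk
    by_contra hn
    rw [kpos z hz] at hk
    simp [indVec, hn] at hk
  refine ⟨k, ⟨k0, k1, fun z A h => h2 A (kw z A h), kmem⟩, ?_⟩
  let q : Finset Ω → ℝ := fun A => ∑ z, p z * k z A
  have q0 : ∀ A, 0 ≤ q A := fun A => Finset.sum_nonneg fun z _ => mul_nonneg (hp.1 z) (k0 z A)
  have q1 : ∑ A : Finset Ω, q A = 1 := by
    show ∑ A : Finset Ω, ∑ z, p z * k z A = 1
    rw [Finset.sum_comm]
    simp only [← Finset.mul_sum, k1, mul_one]
    exact hp.2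
  have qw : ∀ A, 0 < q A → 0 < w A := by
    intro A hq
    obtain ⟨z, _, hz⟩ := Finset.exists_ne_zero_of_sum_ne_zero hq.ne'
    exact kw z A ((k0 z A).lt_of_ne fun h => hz (by rw [← h, mul_zero]))
  have G := aux_gibbs Finset.univ q w q0 h1 qw (by rw [q1, h3])
  have e1 : ∑ A : Finset Ω, q A * Real.logb 2 (q A / w A) =
      ∑ z, ∑ A : Finset Ω, p z * k z A * Real.logb 2 (q A / w A) := by
    rw [Finset.sum_comm]
    exact Finset.sum_congr rfl fun A _ => Finset.sum_mul _ _ _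
  have e2 : MI p k + ∑ A : Finset Ω, q A * Real.logb 2 (q A / w A) =
      ∑ ω, p ω * Real.logb 2 (v ω)⁻¹ := by
    rw [e1]
    unfold MI
    rw [← Finset.sum_add_distrib]
    refine Finset.sum_congr rfl fun z _ => ?_
    rw [← Finset.sum_add_distrib]
    rcases (hp.1 z).eq_or_lt with hz | hz
    · simp [← hz]
    have e3 : ∀ A ∈ (Finset.univ : Finset (Finset Ω)),
        p z * k z A * Real.logb 2 (k z A / ∑ z' : Ω, p z' * k z' A) +
        p z * k z A * Real.logb 2 (q A / w A) = k z A * (p z * Real.logb 2 (v z)⁻¹) := by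
      intro A _
      rcases (k0 z A).eq_or_lt with hk | hk
      · simp [← hk]
      have hw := kw z A hk
      have hq : 0 < q A := lt_of_lt_of_le (mul_pos hz hk)
        (Finset.single_le_sum (f := fun z => p z * k z A)
          (fun z _ => mul_nonneg (hp.1 z) (k0 z A)) (Finset.mem_univ z))
      have hm := kmem z A hz hk
      show p z * k z A * Real.logb 2 (k z A / q A) + _ = _
      rw [← mul_add, ← Real.logb_mul (div_pos hk hq).ne' (div_pos hq hw).ne']
      have : k z A / q A * (q A / w A) = (v z)⁻¹ := by
        rw [div_mul_div_cancel₀ hq.ne', kpos z hz]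
        simp only [indVec, if_pos hm]
        have := hv z hz
        field_simp
      rw [this]; ring
    rw [Finset.sum_congr rfl e3, ← Finset.sum_mul, k1, one_mul]
  linarith

lemma aux_ge [Fintype Ω] (p : Ω → ℝ) (hp : IsPMF p) (X : Finset (Finset Ω))
    (k : Ω → Finset Ω → ℝ) (hk : ValidK p X k) :
    ∃ w : Finset Ω → ℝ, (∀ A, 0 ≤ w A) ∧ (∀ A, 0 < w A → A ∈ X) ∧ ∑ A : Finset Ω, w A = 1 ∧
      (∀ ω, 0 < p ω → 0 < ∑ A : Finset Ω, w A * indVec A ω) ∧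
      ∑ ω, p ω * Real.logb 2 (∑ A : Finset Ω, w A * indVec A ω)⁻¹ ≤ MI p k := by
  obtain ⟨k0, k1, kX, kmem⟩ := hk
  have hi : ∀ (A : Finset Ω) ω, 0 ≤ indVec A ω := fun A ω => by
    unfold indVec; split_ifs <;> norm_num
  let q : Finset Ω → ℝ := fun A => ∑ z, p z * k z A
  have q0 : ∀ A, 0 ≤ q A := fun A => Finset.sum_nonneg fun z _ => mul_nonneg (hp.1 z) (k0 z A)
  have q1 : ∑ A : Finset Ω, q A = 1 := by
    show ∑ A : Finset Ω, ∑ z, p z * k z A = 1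
    rw [Finset.sum_comm]
    simp only [← Finset.mul_sum, k1, mul_one]
    exact hp.2
  have qX : ∀ A, 0 < q A → A ∈ X := by
    intro A hq
    obtain ⟨z, _, hz⟩ := Finset.exists_ne_zero_of_sum_ne_zero hq.ne'
    exact kX z A ((k0 z A).lt_of_ne fun h => hz (by rw [← h, mul_zero]))
  have qpos : ∀ z A, 0 < p z → 0 < k z A → 0 < q A := fun z A hz hk =>
    lt_of_lt_of_le (mul_pos hz hk) (Finset.single_le_sum (f := fun z => p z * k z A)
          (fun z _ => mul_nonneg (hp.1 z) (k0 z A)) (Finset.mem_univ z))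
  have vpos : ∀ ω, 0 < p ω → 0 < ∑ A : Finset Ω, q A * indVec A ω := by
    intro z hz
    obtain ⟨A, _, hA⟩ := Finset.exists_ne_zero_of_sum_ne_zero
      (s := Finset.univ) (f := k z) (by rw [k1]; norm_num)
    have hA' := (k0 z A).lt_of_ne hA.symm
    refine Finset.sum_pos' (fun B _ => mul_nonneg (q0 B) (hi B z)) ⟨A, Finset.mem_univ _, ?_⟩
    simpa [indVec, kmem z A hz hA'] using qpos z A hz hA'
  refine ⟨q, q0, qX, q1, vpos, ?_⟩
  unfold MI
  refine Finset.sum_le_sum fun z _ => ?_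
  rcases (hp.1 z).eq_or_lt with hz | hz
  · simp [← hz]
  have hv := vpos z hz
  set V := ∑ A : Finset Ω, q A * indVec A z with hV
  have G := aux_gibbs Finset.univ (k z) (fun A => q A * indVec A z / V) (k0 z)
    (fun A => div_nonneg (mul_nonneg (q0 A) (hi A z)) hv.le)
    (fun A hA => div_pos (by simpa [indVec, kmem z A hz hA] using qpos z A hz hA) hv)
    (by rw [← Finset.sum_div, ← hV, div_self hv.ne', k1])
  have e : ∀ A ∈ (Finset.univ : Finset (Finset Ω)),
      k z A * Real.logb 2 (k z A / (q A * indVec A z / V)) =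
      k z A * Real.logb 2 (k z A / q A) - k z A * Real.logb 2 V⁻¹ := by
    intro A _
    rcases (k0 z A).eq_or_lt with hk | hk
    · simp [← hk]
    have hq := qpos z A hz hk
    rw [← mul_sub, Real.logb_inv, sub_neg_eq_add,
      ← Real.logb_mul (div_pos hk hq).ne' hv.ne']
    simp only [indVec, if_pos (kmem z A hz hk), mul_one]
    congr 2
    field_simp
  rw [Finset.sum_congr rfl e, Finset.sum_sub_distrib, ← Finset.sum_mul, k1, one_mul] at G
  have := mul_le_mul_of_nonneg_left (sub_nonneg.1 G) hz.le
  rw [Finset.mul_sum] at this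
  simpa only [mul_assoc] using this

/-- The entropy of a hyperconfusion equals the minimum of
`Σ_ω p(ω) log₂(1/v(ω))` over the convex hull of the indicator vectors of members of
`X`, with the conventions `0·log₂(1/0) = 0` and `p(ω)·log₂(1/0) = ∞` when `p(ω) > 0`. -/
theorem stmt1 [Fintype Ω] (p : Ω → ℝ) (hp : IsPMF p)
    (X : Finset (Finset Ω)) (hX : IsHyp X) :
    Hent p X =
      ⨅ v ∈ convexHull ℝ (indVec '' (X : Set (Finset Ω))),
        ∑ ω : Ω, ENNReal.ofReal (p ω) * negLog2 (v ω) := by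
  apply le_antisymm
  · refine le_iInf₂ fun v hv => ?_
    obtain ⟨w, h1, h2, h3, h4⟩ := (aux_hull X v).1 hv
    by_cases hpos : ∀ ω, 0 < p ω → 0 < v ω
    · obtain ⟨k, hk, hle⟩ := aux_le p hp X w v h1 h2 h3 h4 hpos
      rw [aux_sum p v hp.1 hpos fun ω => by rw [h4]; exact aux_le_one w h1 h3 ω]
      exact (iInf₂_le k hk).trans (ENNReal.ofReal_le_ofReal hle)
    · push Not at hpos
      obtain ⟨ω, hω, hv0⟩ := hpos
      have : ∑ ω : Ω, ENNReal.ofReal (p ω) * negLog2 (v ω) = ⊤ := by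
        refine ENNReal.sum_eq_top.2 ⟨ω, Finset.mem_univ _, ?_⟩
        rw [negLog2, if_pos hv0]
        exact ENNReal.mul_top (ENNReal.ofReal_pos.2 hω).ne'
      rw [this]
      exact le_top
  · refine le_iInf₂ fun k hk => ?_
    obtain ⟨w, h1, h2, h3, h4, h5⟩ := aux_ge p hp X k hk
    refine (iInf₂_le (fun ω => ∑ A : Finset Ω, w A * indVec A ω)
      ((aux_hull X _).2 ⟨w, h1, h2, h3, fun _ => rfl⟩)).trans ?_
    rw [aux_sum p _ hp.1 h4 (aux_le_one w h1 h3)]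
    exact ENNReal.ofReal_le_ofReal h5

end
end

section
/- For every hyperconfusion X over a finite probability space (Ω, p), the four entropies are ordered as H∞(X) ≤ H(X) ≤ Hε(X) ≤ H₀(X) (as values in [0,∞]). -/
open Finset
open scoped Classical ENNReal

noncomputable section

variable {Ω : Type*}

lemma MI_eq_aux [Fintype Ω] (p : Ω → ℝ) (k : Ω → Finset Ω → ℝ) :
    MI p k = (∑ z : Ω, ∑ A : Finset Ω,
      p z * k z A * Real.log (k z A / ∑ z' : Ω, p z' * k z' A)) / Real.log 2 := by
  unfold MI Real.logb
  simp only [Finset.sum_div, mul_div_assoc]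

lemma sum_joint_aux [Fintype Ω] {p : Ω → ℝ} (hp : IsPMF p) {k : Ω → Finset Ω → ℝ}
    (hk : ∀ z, ∑ A : Finset Ω, k z A = 1) :
    ∑ z : Ω, ∑ A : Finset Ω, p z * k z A = 1 := by
  simp only [← Finset.mul_sum, hk, mul_one]
  exact hp.2

lemma Hmin_le_aux [Fintype Ω] (p : Ω → ℝ) (hp : IsPMF p)
    (X : Finset (Finset Ω)) (hX : IsHyp X) : Hmin p X ≤ Hent p X := by
  refine le_iInf₂ fun k hk => ?_
  obtain ⟨k0, k1, kX, kz⟩ := hk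
  obtain ⟨B, hB, hmax⟩ := Finset.exists_max_image X (pset p) hX.1
  set M := pset p B with hM
  have hp0 := hp.1
  have hMpos : 0 < M := by
    obtain ⟨z, -, hz⟩ : ∃ z ∈ (univ : Finset Ω), 0 < p z := by
      apply Finset.exists_lt_of_sum_lt
      simp [hp.2]
    obtain ⟨A, -, hA⟩ : ∃ A ∈ (univ : Finset (Finset Ω)), 0 < k z A := by
      apply Finset.exists_lt_of_sum_lt
      simp [k1]
    have h1 := hmax A (kX _ _ hA)
    have h2 : p z ≤ pset p A := Finset.single_le_sum (fun i _ => hp0 i) (kz z A hz hA)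
    linarith
  have hle : Hmin p X ≤ ENNReal.ofReal (Real.logb 2 M⁻¹) := by
    refine (iInf₂_le B hB).trans ?_
    unfold negLog2
    rw [if_neg (not_le.mpr hMpos)]
  refine hle.trans (ENNReal.ofReal_le_ofReal ?_)
  rw [MI_eq_aux, Real.logb]
  refine div_le_div_of_nonneg_right ?_ (Real.log_nonneg (by norm_num))
  set q : Finset Ω → ℝ := fun A => ∑ z' : Ω, p z' * k z' A with hq
  have hq0 : ∀ A, 0 ≤ q A := fun A => Finset.sum_nonneg fun z _ => mul_nonneg (hp0 z) (k0 z A)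
  have hJ := sum_joint_aux hp k1
  have hq1 : ∑ A, q A = 1 := by rw [← hJ, Finset.sum_comm]
  have term : ∀ z A, p z * k z A * (Real.log M⁻¹ + 1) - q A * (if z ∈ A then p z else 0) / M
      ≤ p z * k z A * Real.log (k z A / q A) := by
    intro z A
    rcases (mul_nonneg (hp0 z) (k0 z A)).eq_or_lt with h | h
    · rw [← h]
      have : 0 ≤ q A * (if z ∈ A then p z else 0) / M := by
        have := hq0 A
        have := hp0 z
        split_ifs <;> positivity
      linarith
    · have hpz : 0 < p z := (hp0 z).lt_of_ne (by rintro h'; simp [← h'] at h)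
      have hkz : 0 < k z A := (k0 z A).lt_of_ne (by rintro h'; simp [← h'] at h)
      have hqA : 0 < q A := h.trans_le
        (Finset.single_le_sum (f := fun z => p z * k z A)
          (fun i _ => mul_nonneg (hp0 i) (k0 i A)) (Finset.mem_univ z))
      rw [if_pos (kz z A hpz hkz)]
      have hl := Real.log_le_sub_one_of_pos (x := q A / (k z A * M)) (by positivity)
      rw [Real.log_div (by positivity) (by positivity),
        Real.log_mul (by positivity) (by positivity)] at hl
      rw [Real.log_inv, Real.log_div (by positivity) (by positivity)]
      have e : q A * p z / M = p z * k z A * (q A / (k z A * M)) := by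
        field_simp
      rw [e, ← mul_sub]
      exact mul_le_mul_of_nonneg_left (by linarith) h.le
  have hsum := Finset.sum_le_sum fun z (_ : z ∈ (univ : Finset Ω)) =>
    Finset.sum_le_sum fun A (_ : A ∈ (univ : Finset (Finset Ω))) => term z A
  refine le_trans ?_ hsum
  simp only [Finset.sum_sub_distrib, ← Finset.sum_mul, ← Finset.sum_div]
  rw [hJ, Finset.sum_comm]
  simp only [← Finset.mul_sum]
  have h3 : ∑ A : Finset Ω, q A * ∑ z : Ω, (if z ∈ A then p z else 0) ≤ ∑ A, q A * M := by
    refine Finset.sum_le_sum fun A _ => ?_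
    by_cases hA : A ∈ X
    · refine mul_le_mul_of_nonneg_left ?_ (hq0 A)
      have := hmax A hA
      simpa [pset] using this
    · have : q A = 0 := by
        refine Finset.sum_eq_zero fun z _ => ?_
        have : k z A = 0 := by
          by_contra h
          exact hA (kX z A ((k0 z A).lt_of_ne (Ne.symm h)))
        simp [this]
      simp [this]
  rw [← Finset.sum_mul, hq1, one_mul] at h3
  have := (div_le_one hMpos).2 h3
  linarith

lemma Hent_le_aux [Fintype Ω] (p : Ω → ℝ) (hp : IsPMF p)
    (X : Finset (Finset Ω)) (hX : IsHyp X) : Hent p X ≤ Heps p X := by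
  refine le_iInf₂ fun μ hμ => ?_
  obtain ⟨μ0, μX, μ1⟩ := hμ
  have hp0 := hp.1
  have hempty : (∅ : Finset Ω) ∈ X := by
    obtain ⟨A, hA⟩ := hX.1
    exact hX.2 A hA ∅ (Finset.empty_subset _)
  set s : Ω → ℝ := fun z => ∑ A ∈ X, if z ∈ A then μ A else 0 with hs
  set c := ∑ A ∈ X, μ A with hc
  have hcu : ∑ A, μ A = c := by
    symm
    refine Finset.sum_subset (Finset.subset_univ X) fun A _ hA => ?_
    by_contra h
    exact hA (μX A h)
  have hsu : ∀ z, ∑ A, (if z ∈ A then μ A else 0) = s z := by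
    intro z
    symm
    refine Finset.sum_subset (Finset.subset_univ X) fun A _ hA => ?_
    by_contra h
    exact hA (μX A (fun h' => h (by simp [h'])))
  set k : Ω → Finset Ω → ℝ := fun z A =>
    if 0 < p z then (if z ∈ A then μ A else 0) / s z else if A = ∅ then 1 else 0 with hk
  have k0 : ∀ z A, 0 ≤ k z A := by
    intro z A
    simp only [hk]
    split_ifs with h1 h2 h3
    · exact div_nonneg (μ0 A) (by linarith [μ1 z h1])
    · simp
    · exact zero_le_one
    · exact le_rfl
  have k1 : ∀ z, ∑ A, k z A = 1 := by
    intro z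
    simp only [hk]
    split_ifs with h1
    · rw [← Finset.sum_div, hsu]
      exact div_self (by linarith [μ1 z h1])
    · simp
  have kX : ∀ z A, 0 < k z A → A ∈ X := by
    intro z A h
    simp only [hk] at h
    split_ifs at h with h1 h2 h3
    · exact μX A (fun h' => by simp [h'] at h)
    · simp at h
    · rw [h3]; exact hempty
    · exact absurd h (lt_irrefl _)
  have kz : ∀ z A, 0 < p z → 0 < k z A → z ∈ A := by
    intro z A h1 h
    by_contra h2
    simp [hk, h1, h2] at h
  have kμ : ∀ z A, 0 < p z → k z A ≤ μ A := by
    intro z A h1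
    simp only [hk, if_pos h1]
    have h2 := μ1 z h1
    refine (div_le_self ?_ h2).trans ?_
    · split_ifs
      exacts [μ0 A, le_rfl]
    · split_ifs
      exacts [le_rfl, μ0 A]
  refine (iInf₂_le k ⟨k0, k1, kX, kz⟩).trans (ENNReal.ofReal_le_ofReal ?_)
  rw [MI_eq_aux, Real.logb]
  refine div_le_div_of_nonneg_right ?_ (Real.log_nonneg (by norm_num))
  set q : Finset Ω → ℝ := fun A => ∑ z' : Ω, p z' * k z' A with hq
  have hq0 : ∀ A, 0 ≤ q A := fun A => Finset.sum_nonneg fun z _ => mul_nonneg (hp0 z) (k0 z A)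
  have hJ := sum_joint_aux hp k1
  have hc0 : 0 < c := by
    obtain ⟨z, -, hz⟩ : ∃ z ∈ (univ : Finset Ω), 0 < p z := by
      apply Finset.exists_lt_of_sum_lt
      simp [hp.2]
    refine (zero_lt_one.trans_le (μ1 z hz)).trans_le (Finset.sum_le_sum fun A _ => ?_)
    split_ifs
    exacts [le_rfl, μ0 A]
  have term : ∀ z A, p z * k z A * Real.log (k z A / q A) ≤
      p z * k z A * (Real.log c - 1) + p z * k z A * (μ A / (q A * c)) := by
    intro z A
    rcases (mul_nonneg (hp0 z) (k0 z A)).eq_or_lt with h | h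
    · rw [← h]
      simp
    · have hpz : 0 < p z := (hp0 z).lt_of_ne (by rintro h'; simp [← h'] at h)
      have hkz : 0 < k z A := (k0 z A).lt_of_ne (by rintro h'; simp [← h'] at h)
      have hqA : 0 < q A := h.trans_le
        (Finset.single_le_sum (f := fun z => p z * k z A)
          (fun i _ => mul_nonneg (hp0 i) (k0 i A)) (Finset.mem_univ z))
      have hkm := kμ z A hpz
      have hμA : 0 < μ A := hkz.trans_le hkm
      have hl := Real.log_le_sub_one_of_pos (x := μ A / (q A * c)) (by positivity)
      rw [Real.log_div (by positivity) (by positivity),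
        Real.log_mul (by positivity) (by positivity)] at hl
      rw [Real.log_div (by positivity) (by positivity), ← mul_add]
      have := Real.log_le_log hkz hkm
      exact mul_le_mul_of_nonneg_left (by linarith) h.le
  have hsum := Finset.sum_le_sum fun z (_ : z ∈ (univ : Finset Ω)) =>
    Finset.sum_le_sum fun A (_ : A ∈ (univ : Finset (Finset Ω))) => term z A
  refine hsum.trans ?_
  simp only [Finset.sum_add_distrib, ← Finset.sum_mul]
  rw [hJ, Finset.sum_comm]
  simp only [← Finset.sum_mul]
  have h3 : ∑ A : Finset Ω, q A * (μ A / (q A * c)) ≤ ∑ A, μ A / c := by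
    refine Finset.sum_le_sum fun A _ => ?_
    rcases (hq0 A).eq_or_lt with h | h
    · rw [← h, zero_mul]
      exact div_nonneg (μ0 A) hc0.le
    · apply le_of_eq
      field_simp
  rw [← Finset.sum_div, hcu, div_self hc0.ne'] at h3
  linarith

lemma Heps_le_aux [Fintype Ω] (p : Ω → ℝ) (X : Finset (Finset Ω)) :
    Heps p X ≤ H0ent p X := by
  refine le_iInf₂ fun S hS => ?_
  obtain ⟨hSX, hcov⟩ := hS
  refine (iInf₂_le (fun A => if A ∈ S then (1 : ℝ) else 0) ⟨?_, ?_, ?_⟩).trans ?_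
  · simp [Finset.inter_eq_right.mpr hSX]
  · intro A
    dsimp only
    split_ifs <;> norm_num
  · intro A hA
    by_contra h
    exact hA (if_neg fun h' => h (hSX h'))
  · intro ω hω
    obtain ⟨A, hA, hωA⟩ := hcov ω hω
    refine le_trans ?_ (Finset.single_le_sum (a := A) ?_ (hSX hA))
    · simp [hA, hωA]
    · intro B _
      dsimp only
      split_ifs <;> norm_num

/-- `H∞(X) ≤ H(X) ≤ Hε(X) ≤ H₀(X)`. -/
theorem stmt2 [Fintype Ω] (p : Ω → ℝ) (hp : IsPMF p)
    (X : Finset (Finset Ω)) (hX : IsHyp X) :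
    Hmin p X ≤ Hent p X ∧ Hent p X ≤ Heps p X ∧ Heps p X ≤ H0ent p X := by
  exact ⟨Hmin_le_aux p hp X hX, Hent_le_aux p hp X hX, Heps_le_aux p X⟩

end
end

section
/- (Unconfusing lemma) For any hyperconfusion X over a finite probability space (Ω, p), H(X) ≤ min_{Y ∈ OIs(Ω), Y ⊆ X} H(Y) ≤ H(X) + log₂(H(X) + 3.4) + 1 (where both outer quantities are ∞ when H(X) = ∞). -/
open Finset
open scoped Classical ENNReal

noncomputable section

variable {Ω : Type*}

/-- Jensen step: the potential does not increase on average. -/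
lemma aux_jensen (j : ℕ) (Q : ℝ) (h0 : 0 < Q) (h1 : Q ≤ 1) :
    Q * Real.log ((j : ℝ) + 1) + (1 - Q) * Real.log ((j : ℝ) + 1 + 1 / Q) ≤
      Real.log ((j : ℝ) + 1 / Q) := by
  have hj : (0 : ℝ) ≤ j := Nat.cast_nonneg j
  have hQ : 0 < 1 / Q := by positivity
  have h := strictConcaveOn_log_Ioi.concaveOn.2
    (show (j : ℝ) + 1 ∈ Set.Ioi (0 : ℝ) from by simp only [Set.mem_Ioi]; linarith)
    (show (j : ℝ) + 1 + 1 / Q ∈ Set.Ioi (0 : ℝ) from by simp only [Set.mem_Ioi]; linarith)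
    h0.le (sub_nonneg.2 h1) (by ring)
  simp only [smul_eq_mul] at h
  refine h.trans (le_of_eq ?_)
  congr 1
  field_simp
  ring

lemma aux_step [Fintype Ω] (p : Ω → ℝ) (hp : ∀ z, 0 ≤ p z) (q : Finset Ω → ℝ)
    (hq : ∀ A, 0 ≤ q A) (hq1 : ∑ A : Finset Ω, q A = 1)
    (U : Finset Ω) (hQ : ∀ z ∈ U, 0 < ∑ A : Finset Ω, if z ∈ A then q A else 0) (j : ℕ) :
    ∃ A, 0 < q A ∧ ∑ z ∈ U, p z * (if z ∈ A then Real.log ((j : ℝ) + 1) else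
        Real.log ((j : ℝ) + 1 + 1 / ∑ A : Finset Ω, if z ∈ A then q A else 0)) ≤
      ∑ z ∈ U, p z * Real.log ((j : ℝ) + 1 / ∑ A : Finset Ω, if z ∈ A then q A else 0) := by
  by_contra! hcon
  set Q : Ω → ℝ := fun z => ∑ A : Finset Ω, if z ∈ A then q A else 0 with hQd
  set R := ∑ z ∈ U, p z * Real.log ((j : ℝ) + 1 / Q z) with hR
  obtain ⟨A0, hA0⟩ : ∃ A, 0 < q A := by
    by_contra! h
    have : ∑ A : Finset Ω, q A ≤ 0 := Finset.sum_nonpos fun A _ => h A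
    linarith
  have h1 : ∑ A : Finset Ω, q A * R < ∑ A : Finset Ω, q A *
      ∑ z ∈ U, p z * (if z ∈ A then Real.log ((j : ℝ) + 1) else
        Real.log ((j : ℝ) + 1 + 1 / Q z)) := by
    apply Finset.sum_lt_sum
    · intro A _
      rcases (hq A).eq_or_lt with h | h
      · simp [← h]
      · exact mul_le_mul_of_nonneg_left (hcon A h).le h.le
    · exact ⟨A0, Finset.mem_univ _, mul_lt_mul_of_pos_left (hcon A0 hA0) hA0⟩
  rw [← Finset.sum_mul, hq1, one_mul] at h1
  simp_rw [Finset.mul_sum] at h1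
  rw [Finset.sum_comm] at h1
  refine absurd h1 (not_lt.2 ?_)
  rw [hR]
  apply Finset.sum_le_sum
  intro z hz
  have hQ1 : Q z ≤ 1 := by
    rw [← hq1]
    apply Finset.sum_le_sum
    intro A _
    split_ifs
    · exact le_rfl
    · exact hq A
  have e : ∑ A : Finset Ω, q A * (p z * (if z ∈ A then Real.log ((j : ℝ) + 1) else
        Real.log ((j : ℝ) + 1 + 1 / Q z))) =
      p z * (Q z * Real.log ((j : ℝ) + 1) + (1 - Q z) * Real.log ((j : ℝ) + 1 + 1 / Q z)) := by
    have : 1 - Q z = ∑ A : Finset Ω, (q A - if z ∈ A then q A else 0) := by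
      rw [Finset.sum_sub_distrib, hq1]
    rw [this, hQd]
    simp only
    rw [Finset.sum_mul, Finset.sum_mul, ← Finset.sum_add_distrib, Finset.mul_sum]
    apply Finset.sum_congr rfl
    intro A _
    split_ifs <;> ring
  rw [e]
  exact mul_le_mul_of_nonneg_left (aux_jensen j (Q z) (hQ z hz) hQ1) (hp z)

lemma aux_cover [Fintype Ω] (p : Ω → ℝ) (hp : ∀ z, 0 ≤ p z) (X : Finset (Finset Ω))
    (hX : IsHyp X) (q : Finset Ω → ℝ)
    (hq : ∀ A, 0 ≤ q A) (hq1 : ∑ A : Finset Ω, q A = 1) (hqX : ∀ A, 0 < q A → A ∈ X) :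
    ∀ (n : ℕ) (U : Finset Ω), U.card = n → (∀ z ∈ U, 0 < p z) →
    (∀ z ∈ U, 0 < ∑ A : Finset Ω, if z ∈ A then q A else 0) → ∀ (j : ℕ),
    ∃ K : Ω → ℕ, (∀ z ∈ U, j + 1 ≤ K z) ∧ (∀ m, U.filter (fun z => K z = m) ∈ X) ∧
      ∑ z ∈ U, p z * Real.log (K z) ≤
      ∑ z ∈ U, p z * Real.log ((j : ℝ) + 1 / ∑ A : Finset Ω, if z ∈ A then q A else 0) := by
  intro n
  induction n using Nat.strong_induction_on with
  | _ n ih =>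
  intro U hU hpU hQ j
  have hempty : (∅ : Finset Ω) ∈ X := by
    obtain ⟨A, hA⟩ := hX.1
    exact hX.2 A hA ∅ (Finset.empty_subset _)
  rcases U.eq_empty_or_nonempty with rfl | hne
  · exact ⟨fun _ => 0, by simp, by simpa using hempty, by simp⟩
  obtain ⟨A, hA, hstep⟩ := aux_step p hp q hq hq1 U hQ j
  have hint : ∃ z ∈ U, z ∈ A := by
    by_contra! h
    refine absurd hstep (not_le.2 ?_)
    apply Finset.sum_lt_sum_of_nonempty hne
    intro z hz
    rw [if_neg (h z hz)]
    have := hQ z hz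
    exact mul_lt_mul_of_pos_left (Real.log_lt_log (by positivity) (by linarith)) (hpU z hz)
  obtain ⟨z0, hz0, hz0A⟩ := hint
  obtain ⟨K, hK1, hK2, hK3⟩ := ih (U \ A).card (by
    rw [← hU]
    apply Finset.card_lt_card
    refine ⟨Finset.sdiff_subset, fun h => ?_⟩
    have := h hz0
    simp [hz0A] at this) (U \ A) rfl
    (fun z hz => hpU z (Finset.sdiff_subset hz)) (fun z hz => hQ z (Finset.sdiff_subset hz)) (j + 1)
  refine ⟨fun z => if z ∈ A then j + 1 else K z, ?_, ?_, ?_⟩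
  · intro z hz
    dsimp only
    split_ifs with h
    · exact le_rfl
    · have := hK1 z (by simp [hz, h])
      omega
  · intro m
    by_cases hm : m = j + 1
    · refine hX.2 A (hqX A hA) _ ?_
      intro z hz
      simp only [Finset.mem_filter] at hz
      by_contra h
      have h2 := hK1 z (by simp [hz.1, h])
      rw [if_neg h] at hz
      omega
    · refine hX.2 _ (hK2 m) _ ?_
      intro z hz
      simp only [Finset.mem_filter, Finset.mem_sdiff] at hz ⊢
      by_cases h : z ∈ A
      · rw [if_pos h] at hz
        omega
      · rw [if_neg h] at hz
        exact ⟨⟨hz.1, h⟩, hz.2⟩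
  · refine le_trans ?_ hstep
    rw [← Finset.sum_sdiff (Finset.inter_subset_left : U ∩ A ⊆ U),
      ← Finset.sum_sdiff (Finset.inter_subset_left : U ∩ A ⊆ U)]
    apply add_le_add
    · rw [Finset.sdiff_inter_self_left]
      refine le_trans (le_of_eq ?_) (hK3.trans (le_of_eq ?_))
      · apply Finset.sum_congr rfl
        intro z hz
        dsimp only
        rw [if_neg (Finset.mem_sdiff.1 hz).2]
      · apply Finset.sum_congr rfl
        intro z hz
        rw [if_neg (Finset.mem_sdiff.1 hz).2]
        push_cast
        rfl
    · apply le_of_eq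
      apply Finset.sum_congr rfl
      intro z hz
      dsimp only
      rw [if_pos (Finset.mem_inter.1 hz).2, if_pos (Finset.mem_inter.1 hz).2]
      push_cast
      rfl

lemma aux_zeta (a : ℝ) (ha : 0 < a) (N : ℕ) :
    ∑ m ∈ Finset.range (N + 1), ((m : ℝ) + 1) ^ (-(1 + a)) ≤
      1 + 1 / a - 1 / a * ((N : ℝ) + 1) ^ (-a) := by
  induction N with
  | zero => simp
  | succ N ih =>
    rw [Finset.sum_range_succ]
    set x : ℝ := (N : ℝ) + 1 with hx
    have hx1 : 0 < x := by positivity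
    have e1 : (((N + 1 : ℕ) : ℝ) + 1) = x + 1 := by push_cast; ring
    rw [e1]
    have key : a * (x + 1) ^ (-(1 + a)) ≤ x ^ (-a) - (x + 1) ^ (-a) := by
      have h1 : (x + 1) ^ (-(1 + a)) = (x + 1) ^ (-a) * (1 / (x + 1)) := by
        rw [show -(1 + a) = -a - 1 by ring, Real.rpow_sub_one (by positivity)]
        ring
      have h2 : x ^ (-a) = (x + 1) ^ (-a) * Real.exp (a * (Real.log (x + 1) - Real.log x)) := by
        rw [Real.rpow_def_of_pos hx1, Real.rpow_def_of_pos (by positivity), ← Real.exp_add]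
        congr 1
        ring
      have h3 : 1 / (x + 1) ≤ Real.log (x + 1) - Real.log x := by
        have := Real.log_le_sub_one_of_pos (show 0 < x / (x + 1) by positivity)
        rw [Real.log_div hx1.ne' (by positivity)] at this
        have e : x / (x + 1) - 1 = - (1 / (x + 1)) := by field_simp; ring
        linarith
      have h4 : 1 + a * (1 / (x + 1)) ≤ Real.exp (a * (Real.log (x + 1) - Real.log x)) := by
        have h5 := Real.add_one_le_exp (a * (Real.log (x + 1) - Real.log x))
        have h6 := mul_le_mul_of_nonneg_left h3 ha.le
        linarith
      have hpos : 0 < (x + 1) ^ (-a) := by positivity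
      have := mul_le_mul_of_nonneg_left h4 hpos.le
      rw [h1, h2]
      nlinarith
    have key2 : (x + 1) ^ (-(1 + a)) ≤ 1 / a * (x ^ (-a) - (x + 1) ^ (-a)) := by
      rw [div_mul_eq_mul_div, le_div_iff₀ ha]
      linarith
    linarith

lemma aux_zeta_finset (a : ℝ) (ha : 0 < a) (T : Finset ℕ) (hT : ∀ m ∈ T, 1 ≤ m) :
    ∑ m ∈ T, (m : ℝ) ^ (-(1 + a)) ≤ 1 + 1 / a := by
  have h := aux_zeta a ha (T.sup id)
  have h2 : ∑ m ∈ T, (m : ℝ) ^ (-(1 + a)) ≤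
      ∑ m ∈ Finset.range (T.sup id + 1), ((m : ℝ) + 1) ^ (-(1 + a)) := by
    have e : ∑ m ∈ Finset.range (T.sup id + 1), ((m : ℝ) + 1) ^ (-(1 + a)) =
        ∑ m ∈ (Finset.range (T.sup id + 1)).image (fun i : ℕ => i + 1), ((m : ℕ) : ℝ) ^ (-(1 + a)) := by
      rw [Finset.sum_image (by intro a _ b _ h; simpa using h)]
      simp
    rw [e]
    apply Finset.sum_le_sum_of_subset_of_nonneg
    · intro m hm
      have h1 := hT m hm
      have h3 : m ≤ T.sup id := Finset.le_sup (f := id) hm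
      simp only [Finset.mem_image, Finset.mem_range]
      exact ⟨m - 1, by omega, by omega⟩
    · intros; positivity
  have : 0 ≤ 1 / a * (((T.sup id : ℕ) : ℝ) + 1) ^ (-a) := by positivity
  linarith

/-- Entropy (nats) of an integer label versus power-law code. -/
lemma aux_entropy [Fintype Ω] (p : Ω → ℝ) (U : Finset Ω) (hU : ∀ z ∈ U, 0 < p z)
    (hU1 : ∑ z ∈ U, p z = 1) (K : Ω → ℕ) (hK : ∀ z ∈ U, 1 ≤ K z) (a : ℝ) (ha : 0 < a) :
    ∑ z ∈ U, p z * (- Real.log (∑ z' ∈ U.filter (fun z' => K z' = K z), p z')) ≤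
      (1 + a) * ∑ z ∈ U, p z * Real.log (K z) + Real.log (1 + 1 / a) := by
  set P : ℕ → ℝ := fun m => ∑ z' ∈ U.filter (fun z' => K z' = m), p z' with hP
  set C : ℝ := 1 + 1 / a with hC
  have hCpos : 0 < C := by positivity
  have hPpos : ∀ z ∈ U, 0 < P (K z) := by
    intro z hz
    apply Finset.sum_pos
    · intro w hw
      exact hU w (Finset.mem_filter.1 hw).1
    · exact ⟨z, by simp [hz]⟩
  have h1 : ∀ z ∈ U, p z * (-Real.log (P (K z)) - (1 + a) * Real.log (K z) - Real.log C) ≤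
      p z * ((K z : ℝ) ^ (-(1 + a)) / C / P (K z) - 1) := by
    intro z hz
    apply mul_le_mul_of_nonneg_left _ (hU z hz).le
    have hKp : (0 : ℝ) < K z := by exact_mod_cast hK z hz
    have hPp := hPpos z hz
    have hr : 0 < (K z : ℝ) ^ (-(1 + a)) := by positivity
    have := Real.log_le_sub_one_of_pos
      (show 0 < (K z : ℝ) ^ (-(1 + a)) / C / P (K z) by positivity)
    rw [Real.log_div (by positivity) hPp.ne', Real.log_div hr.ne' hCpos.ne',
      Real.log_rpow hKp] at this
    linarith
  have h2 := Finset.sum_le_sum h1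
  have h3 : ∑ z ∈ U, p z * ((K z : ℝ) ^ (-(1 + a)) / C / P (K z) - 1) ≤ 0 := by
    have e1 : ∑ z ∈ U, p z * ((K z : ℝ) ^ (-(1 + a)) / C / P (K z) - 1) =
        ∑ z ∈ U, p z * ((K z : ℝ) ^ (-(1 + a)) / C / P (K z)) - 1 := by
      simp_rw [mul_sub, mul_one]
      rw [Finset.sum_sub_distrib, hU1]
    have e2 : ∑ z ∈ U, p z * ((K z : ℝ) ^ (-(1 + a)) / C / P (K z)) =
        ∑ m ∈ U.image K, (m : ℝ) ^ (-(1 + a)) / C := by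
      rw [← Finset.sum_fiberwise_of_maps_to (fun z hz => Finset.mem_image_of_mem K hz)]
      apply Finset.sum_congr rfl
      intro m hm
      obtain ⟨z, hz, rfl⟩ := Finset.mem_image.1 hm
      have hPp := hPpos z hz
      have : ∀ w ∈ U.filter (fun w => K w = K z),
          p w * ((K w : ℝ) ^ (-(1 + a)) / C / P (K w)) =
          p w * ((K z : ℝ) ^ (-(1 + a)) / C / P (K z)) := by
        intro w hw
        rw [(Finset.mem_filter.1 hw).2]
      rw [Finset.sum_congr rfl this, ← Finset.sum_mul]
      change P (K z) * _ = _
      field_simp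
    rw [e1, e2, ← Finset.sum_div]
    have := aux_zeta_finset a ha (U.image K) (by
      intro m hm
      obtain ⟨z, hz, rfl⟩ := Finset.mem_image.1 hm
      exact hK z hz)
    have : (∑ m ∈ U.image K, (m : ℝ) ^ (-(1 + a))) / C ≤ 1 := by
      rw [div_le_one hCpos]; exact this
    linarith
  have e : ∑ z ∈ U, p z * (-Real.log (P (K z)) - (1 + a) * Real.log (K z) - Real.log C) =
      ∑ z ∈ U, p z * (-Real.log (P (K z))) - (1 + a) * ∑ z ∈ U, p z * Real.log (K z)
        - Real.log C := by
    have : Real.log C = ∑ z ∈ U, p z * Real.log C := by rw [← Finset.sum_mul, hU1, one_mul]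
    conv_rhs => rw [this]
    rw [Finset.mul_sum, ← Finset.sum_sub_distrib, ← Finset.sum_sub_distrib]
    exact Finset.sum_congr rfl fun z _ => by ring
  linarith

/-- Lower bound for mutual information (nats). -/
lemma aux_MI_lower [Fintype Ω] (p : Ω → ℝ) (hp : IsPMF p) (X : Finset (Finset Ω))
    (k : Ω → Finset Ω → ℝ) (hk : ValidK p X k) :
    ∑ z ∈ univ.filter (fun z => 0 < p z), p z * Real.log ((0 : ℕ) + 1 /
      ∑ A : Finset Ω, if z ∈ A then (∑ z' : Ω, p z' * k z' A) else 0) ≤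
      MI p k * Real.log 2 := by
  obtain ⟨hk0, hk1, hkX, hkm⟩ := hk
  set q : Finset Ω → ℝ := fun A => ∑ z' : Ω, p z' * k z' A with hqd
  have hq0 : ∀ A, 0 ≤ q A := fun A =>
    Finset.sum_nonneg fun z _ => mul_nonneg (hp.1 z) (hk0 z A)
  have hl2 : Real.log 2 ≠ 0 := (Real.log_pos (by norm_num)).ne'
  have e : MI p k * Real.log 2 = ∑ z : Ω, p z * ∑ A : Finset Ω, k z A * Real.log (k z A / q A) := by
    unfold MI
    rw [Finset.sum_mul]
    apply Finset.sum_congr rfl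
    intro z _
    rw [Finset.sum_mul, Finset.mul_sum]
    apply Finset.sum_congr rfl
    intro A _
    rw [Real.logb]
    field_simp
    rfl
  rw [e, Finset.sum_filter]
  apply Finset.sum_le_sum
  intro z _
  split_ifs with hz
  swap
  · have : p z = 0 := le_antisymm (not_lt.1 hz) (hp.1 z)
    simp [this]
  apply mul_le_mul_of_nonneg_left _ hz.le
  set Q : ℝ := ∑ A : Finset Ω, if z ∈ A then q A else 0 with hQd
  have hqpos : ∀ A, 0 < k z A → 0 < q A := by
    intro A hA
    have : p z * k z A ≤ q A := Finset.single_le_sum (f := fun z' => p z' * k z' A)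
      (fun w _ => mul_nonneg (hp.1 w) (hk0 w A)) (Finset.mem_univ z)
    have := mul_pos hz hA
    linarith
  have hQpos : 0 < Q := by
    obtain ⟨A, hA⟩ : ∃ A, 0 < k z A := by
      by_contra! h
      have : ∑ A : Finset Ω, k z A ≤ 0 := Finset.sum_nonpos fun A _ => h A
      have := hk1 z
      linarith
    apply Finset.sum_pos'
    · intro A _
      split_ifs
      · exact hq0 A
      · exact le_rfl
    · exact ⟨A, Finset.mem_univ _, by rw [if_pos (hkm z A hz hA)]; exact hqpos A hA⟩
  have h1 : ∀ A : Finset Ω, k z A - (if z ∈ A then q A else 0) / Q ≤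
      k z A * Real.log (k z A / q A) + k z A * Real.log Q := by
    intro A
    rcases (hk0 z A).eq_or_lt with h | h
    · rw [← h]
      have : 0 ≤ (if z ∈ A then q A else 0) / Q := by
        apply div_nonneg _ hQpos.le
        split_ifs
        · exact hq0 A
        · exact le_rfl
      simp only [zero_mul, add_zero]
      linarith
    · rw [if_pos (hkm z A hz h)]
      have hqA := hqpos A h
      have := Real.log_le_sub_one_of_pos (show 0 < q A / (k z A * Q) by positivity)
      rw [Real.log_div hqA.ne' (by positivity), Real.log_mul h.ne' hQpos.ne'] at this
      rw [Real.log_div h.ne' hqA.ne']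
      have h3 := mul_le_mul_of_nonneg_left this h.le
      have e3 : k z A * (q A / (k z A * Q) - 1) = q A / Q - k z A := by field_simp
      rw [e3] at h3
      linarith
  have h2 := Finset.sum_le_sum fun A (_ : A ∈ Finset.univ) => h1 A
  rw [Finset.sum_sub_distrib, Finset.sum_add_distrib, ← Finset.sum_mul, hk1,
    ← Finset.sum_div, div_self hQpos.ne'] at h2
  simp only [Nat.cast_zero, zero_add, one_div, Real.log_inv]
  linarith

lemma aux_final (J : ℝ) (hJ : 0 ≤ J) :
    (1 + 1 / (J + 1)) * J + Real.log (1 + 1 / (1 / (J + 1))) ≤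
      J + Real.log (J / Real.log 2 + 3.4) + Real.log 2 := by
  have hl1 := Real.log_two_gt_d9
  have hl2 := Real.log_two_lt_d9
  have he := Real.exp_one_lt_d9
  have h1 : (1 + 1 / (J + 1)) * J ≤ J + 1 := by
    have : 1 / (J + 1) * J ≤ 1 := by
      rw [div_mul_eq_mul_div, div_le_one (by positivity)]; linarith
    linarith
  have h2 : (1 : ℝ) + 1 / (1 / (J + 1)) = J + 2 := by rw [one_div_one_div]; ring
  rw [h2]
  have hJl : 1.4 * J ≤ J / Real.log 2 := by
    rw [le_div_iff₀ (by linarith)]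
    nlinarith
  have h3 : 1 + Real.log (J + 2) ≤ Real.log (J / Real.log 2 + 3.4) + Real.log 2 := by
    rw [← Real.log_mul (by positivity) (by norm_num)]
    conv_lhs => rw [← Real.log_exp 1]
    rw [← Real.log_mul (by positivity) (by positivity)]
    apply Real.log_le_log (by positivity)
    nlinarith
  linarith

lemma aux_main [Fintype Ω] (p : Ω → ℝ) (hp : IsPMF p) (X : Finset (Finset Ω)) (hX : IsHyp X)
    (k : Ω → Finset Ω → ℝ) (hk : ValidK p X k) :
    0 ≤ MI p k ∧ ∃ Y, (IsOI Y ∧ Y ⊆ X) ∧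
      Hent p Y ≤ ENNReal.ofReal (MI p k + Real.logb 2 (MI p k + 3.4) + 1) := by
  have hlow := aux_MI_lower p hp X k hk
  have hk' := hk
  obtain ⟨hk0, hk1, hkX, hkm⟩ := hk'
  set q : Finset Ω → ℝ := fun A => ∑ z' : Ω, p z' * k z' A with hqd
  set U : Finset Ω := univ.filter (fun z => 0 < p z) with hUd
  have hl2 : 0 < Real.log 2 := Real.log_pos (by norm_num)
  have hq0 : ∀ A, 0 ≤ q A := fun A =>
    Finset.sum_nonneg fun z _ => mul_nonneg (hp.1 z) (hk0 z A)
  have hq1 : ∑ A : Finset Ω, q A = 1 := by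
    rw [hqd, Finset.sum_comm]
    simp_rw [← Finset.mul_sum, hk1, mul_one]
    exact hp.2
  have hqX : ∀ A, 0 < q A → A ∈ X := by
    intro A hA
    by_contra h
    have : q A = 0 := Finset.sum_eq_zero fun z _ => by
      have : k z A = 0 := le_antisymm (not_lt.1 fun h' => h (hkX z A h')) (hk0 z A)
      rw [this, mul_zero]
    linarith
  have hUp : ∀ z ∈ U, 0 < p z := fun z hz => (Finset.mem_filter.1 hz).2
  have hU1 : ∑ z ∈ U, p z = 1 := by
    rw [← hp.2, hUd, Finset.sum_filter]
    apply Finset.sum_congr rfl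
    intro z _
    split_ifs with h
    · rfl
    · exact le_antisymm (hp.1 z) (not_lt.1 h)
  have hQpos : ∀ z ∈ U, 0 < ∑ A : Finset Ω, if z ∈ A then q A else 0 := by
    intro z hz
    have hzp := hUp z hz
    obtain ⟨A, hA⟩ : ∃ A, 0 < k z A := by
      by_contra! h
      have : ∑ A : Finset Ω, k z A ≤ 0 := Finset.sum_nonpos fun A _ => h A
      have := hk1 z
      linarith
    apply Finset.sum_pos'
    · intro A _
      split_ifs
      · exact hq0 A
      · exact le_rfl
    · refine ⟨A, Finset.mem_univ _, ?_⟩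
      rw [if_pos (hkm z A hzp hA)]
      have : p z * k z A ≤ q A := Finset.single_le_sum (f := fun z' => p z' * k z' A)
        (fun w _ => mul_nonneg (hp.1 w) (hk0 w A)) (Finset.mem_univ z)
      have := mul_pos hzp hA
      linarith
  obtain ⟨K, hK1, hK2, hK3⟩ := aux_cover p hp.1 X hX q hq0 hq1 hqX _ U rfl hUp hQpos 0
  have hE : ∑ z ∈ U, p z * Real.log (K z) ≤ MI p k * Real.log 2 := hK3.trans hlow
  have hE0 : 0 ≤ ∑ z ∈ U, p z * Real.log (K z) :=
    Finset.sum_nonneg fun z hz => mul_nonneg (hUp z hz).le (Real.log_natCast_nonneg _)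
  have hI0 : 0 ≤ MI p k := by
    by_contra h
    have := mul_neg_of_neg_of_pos (not_le.1 h) hl2
    linarith
  refine ⟨hI0, ?_⟩
  set J := MI p k * Real.log 2 with hJ
  have hJ0 : 0 ≤ J := by positivity
  have ha : 0 < 1 / (J + 1) := by positivity
  have hent := aux_entropy p U hUp hU1 K (fun z hz => by simpa using hK1 z hz) _ ha
  have hfin := aux_final J hJ0
  have hbound : ∑ z ∈ U, p z * (- Real.log (∑ z' ∈ U.filter (fun z' => K z' = K z), p z')) ≤
      J + Real.log (J / Real.log 2 + 3.4) + Real.log 2 := by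
    refine hent.trans (le_trans ?_ hfin)
    have := mul_le_mul_of_nonneg_left hE (show 0 ≤ 1 + 1 / (J + 1) by positivity)
    linarith
  have hJI : J / Real.log 2 = MI p k := by rw [hJ]; field_simp
  rw [hJI] at hbound
  have hempty : (∅ : Finset Ω) ∈ X := by
    obtain ⟨A, hA⟩ := hX.1
    exact hX.2 A hA ∅ (Finset.empty_subset _)
  set F : ℕ → Finset Ω := fun m => U.filter (fun z => K z = m) with hF
  set S : Finset (Finset Ω) := insert ∅ (U.image (fun z => F (K z))) with hS
  set Y : Finset (Finset Ω) := univ.filter (fun C => ∃ A ∈ S, C ⊆ A) with hY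
  have hSX : ∀ A ∈ S, A ∈ X := by
    intro A hA
    rw [hS, Finset.mem_insert, Finset.mem_image] at hA
    rcases hA with rfl | ⟨z, _, rfl⟩
    · exact hempty
    · exact hK2 _
  have hSY : ∀ A ∈ S, A ∈ Y := by
    intro A hA
    rw [hY, Finset.mem_filter]
    exact ⟨Finset.mem_univ _, A, hA, subset_rfl⟩
  refine ⟨Y, ⟨⟨S, ⟨∅, by simp [hS]⟩, ?_, ?_⟩, ?_⟩, ?_⟩
  · intro A hA B hB hAB
    rw [hS, Finset.mem_insert, Finset.mem_image] at hA hB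
    rcases hA with rfl | ⟨z, _, rfl⟩
    · simp
    rcases hB with rfl | ⟨w, _, rfl⟩
    · simp
    rw [Finset.disjoint_left]
    intro x hx hx'
    have h1 := (Finset.mem_filter.1 hx).2
    have h2 := (Finset.mem_filter.1 hx').2
    exact hAB (by rw [← h1, ← h2])
  · intro C
    simp [hY]
  · intro C hC
    obtain ⟨A, hA, hCA⟩ := (Finset.mem_filter.1 hC).2
    exact hX.2 A (hSX A hA) C hCA
  · set G : Ω → Finset Ω := fun z => if z ∈ U then F (K z) else ∅ with hG
    set k' : Ω → Finset Ω → ℝ := fun z A => if A = G z then 1 else 0 with hk'd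
    have hGS : ∀ z, G z ∈ S := by
      intro z
      simp only [hG, hS]
      split_ifs with h
      · exact Finset.mem_insert_of_mem (Finset.mem_image_of_mem (fun z => F (K z)) h)
      · simp
    have hval : ValidK p Y k' := by
      refine ⟨?_, ?_, ?_, ?_⟩
      · intro z A
        simp only [hk'd]
        split_ifs <;> norm_num
      · intro z
        simp [hk'd]
      · intro z A h
        simp only [hk'd] at h
        split_ifs at h with h'
        · rw [h']
          exact hSY _ (hGS z)
        · exact absurd h (lt_irrefl _)
      · intro z A hz h
        simp only [hk'd] at h
        split_ifs at h with h'
        · have hzU : z ∈ U := by simp [hUd, hz]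
          rw [h', hG]
          simp only [if_pos hzU]
          simp [hF, hzU]
        · exact absurd h (lt_irrefl _)
    refine (iInf₂_le k' hval).trans (ENNReal.ofReal_le_ofReal ?_)
    have hMI : MI p k' * Real.log 2 =
        ∑ z ∈ U, p z * (- Real.log (∑ z' ∈ U.filter (fun z' => K z' = K z), p z')) := by
      have hq' : ∀ z ∈ U, ∑ z' : Ω, p z' * k' z' (G z) =
          ∑ z' ∈ U.filter (fun z' => K z' = K z), p z' := by
        intro z hz
        rw [Finset.sum_filter, hUd, Finset.sum_filter]
        apply Finset.sum_congr rfl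
        intro w _
        by_cases hw : 0 < p w
        · have hwU : w ∈ U := by simp [hUd, hw]
          rw [if_pos hw]
          have : G z = G w ↔ K w = K z := by
            simp only [hG, if_pos hz, if_pos hwU]
            constructor
            · intro h
              have : w ∈ F (K z) := by rw [h]; simp [hF, hwU]
              exact (Finset.mem_filter.1 this).2
            · intro h
              rw [h]
          simp only [hk'd, this]
          split_ifs <;> simp
        · have : p w = 0 := le_antisymm (not_lt.1 hw) (hp.1 w)
          simp [this]
      unfold MI
      rw [Finset.sum_mul, hUd, Finset.sum_filter]
      apply Finset.sum_congr rfl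
      intro z _
      by_cases hz : 0 < p z
      · have hzU : z ∈ U := by simp [hUd, hz]
        rw [if_pos hz, Finset.sum_eq_single (G z)]
        · rw [hq' z hzU]
          have : k' z (G z) = 1 := by simp [hk'd]
          rw [this, one_div, Real.logb, Real.log_inv]
          field_simp
          rfl
        · intro A _ hA
          have : k' z A = 0 := by simp [hk'd, hA]
          rw [this]
          simp
        · simp
      · have : p z = 0 := le_antisymm (not_lt.1 hz) (hp.1 z)
        simp [this]
    have e : (MI p k + Real.logb 2 (MI p k + 3.4) + 1) * Real.log 2 =
        J + Real.log (MI p k + 3.4) + Real.log 2 := by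
      rw [Real.logb, hJ]
      field_simp
    refine le_of_mul_le_mul_right ?_ hl2
    rw [e, hMI]
    exact hbound

/-- **Unconfusing lemma.** The least entropy of an ordinary information
refining `X` lies between `H(X)` and `H(X) + log₂(H(X) + 3.4) + 1`. -/
theorem stmt7 [Fintype Ω] (p : Ω → ℝ) (hp : IsPMF p)
    (X : Finset (Finset Ω)) (hX : IsHyp X) :
    Hent p X ≤ (⨅ (Y : Finset (Finset Ω)) (_ : IsOI Y ∧ Y ⊆ X), Hent p Y) ∧
    (⨅ (Y : Finset (Finset Ω)) (_ : IsOI Y ∧ Y ⊆ X), Hent p Y) ≤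
      Hent p X + elog2 (Hent p X + ENNReal.ofReal 3.4) + 1 := by
  constructor
  · refine le_iInf₂ fun Y hY => le_iInf₂ fun k hk => iInf₂_le k ?_
    exact ⟨hk.1, hk.2.1, fun z A h => hY.2 (hk.2.2.1 z A h), hk.2.2.2⟩
  · set M : ℝ≥0∞ := ⨅ (Y : Finset (Finset Ω)) (_ : IsOI Y ∧ Y ⊆ X), Hent p Y with hM
    by_cases htop : Hent p X = ⊤
    · simp [htop]
    set h : ℝ := (Hent p X).toReal with hh
    have hh0 : 0 ≤ h := ENNReal.toReal_nonneg
    have hHh : Hent p X = ENNReal.ofReal h := (ENNReal.ofReal_toReal htop).symm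
    have hlogn : 0 ≤ Real.logb 2 (h + 3.4) := Real.logb_nonneg (by norm_num) (by linarith)
    have hrhs : Hent p X + elog2 (Hent p X + ENNReal.ofReal 3.4) + 1 =
        ENNReal.ofReal (h + Real.logb 2 (h + 3.4) + 1) := by
      rw [hHh, ← ENNReal.ofReal_add hh0 (by norm_num), elog2, if_neg ENNReal.ofReal_ne_top,
        ENNReal.toReal_ofReal (by linarith), ← ENNReal.ofReal_add hh0 hlogn,
        ← ENNReal.ofReal_one, ← ENNReal.ofReal_add (by linarith) (by norm_num)]
    rw [hrhs]
    have hstep : ∀ x : ℝ, h < x → M ≤ ENNReal.ofReal (x + Real.logb 2 (x + 3.4) + 1) := by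
      intro x hx
      have hlt : Hent p X < ENNReal.ofReal x := by
        rw [hHh]
        exact (ENNReal.ofReal_lt_ofReal_iff (by linarith)).2 hx
      unfold Hent at hlt
      obtain ⟨k, hk⟩ := iInf_lt_iff.1 hlt
      obtain ⟨hv, hk⟩ := iInf_lt_iff.1 hk
      obtain ⟨hI, Y, hY, hYb⟩ := aux_main p hp X hX k hv
      have hIx : MI p k ≤ x := ((ENNReal.ofReal_lt_ofReal_iff (by linarith)).1 hk).le
      refine (iInf₂_le Y hY).trans (hYb.trans (ENNReal.ofReal_le_ofReal ?_))
      have := Real.logb_le_logb_of_le (b := 2) (by norm_num)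
        (show 0 < MI p k + 3.4 by linarith) (show MI p k + 3.4 ≤ x + 3.4 by linarith)
      linarith
    have hcont : Filter.Tendsto (fun x : ℝ => ENNReal.ofReal (x + Real.logb 2 (x + 3.4) + 1))
        (nhdsWithin h (Set.Ioi h)) (nhds (ENNReal.ofReal (h + Real.logb 2 (h + 3.4) + 1))) := by
      apply ENNReal.tendsto_ofReal
      apply Filter.Tendsto.mono_left _ nhdsWithin_le_nhds
      have : ContinuousAt (fun x : ℝ => x + Real.logb 2 (x + 3.4) + 1) h := by
        unfold Real.logb
        have hne : h + 3.4 ≠ 0 := by linarith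
        fun_prop (disch := assumption)
      exact this
    exact ge_of_tendsto hcont (Filter.eventually_of_mem self_mem_nhdsWithin fun x hx => hstep x hx)
end
end

section
/- (Unconfusing lemma for H₀ and H∞) For any hyperconfusion X over a finite probability space (Ω, p): min_{Y ∈ OIs(Ω), Y ⊆ X} H₀(Y) = H₀(X), and min_{Y ∈ OIs(Ω), Y ⊆ X} H∞(Y) = H∞(X). -/
open Finset
open scoped Classical ENNReal

noncomputable section

variable {Ω : Type*}

/-- **Unconfusing lemma for `H₀` and `H∞`.** The least `H₀`
(resp. `H∞`) of an ordinary information refining `X` equals `H₀(X)` (resp. `H∞(X)`). -/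
theorem stmt8 [Fintype Ω] (p : Ω → ℝ) (hp : IsPMF p)
    (X : Finset (Finset Ω)) (hX : IsHyp X) :
    (⨅ (Y : Finset (Finset Ω)) (_ : IsOI Y ∧ Y ⊆ X), H0ent p Y) = H0ent p X ∧
    (⨅ (Y : Finset (Finset Ω)) (_ : IsOI Y ∧ Y ⊆ X), Hmin p Y) = Hmin p X := by
  constructor
  · apply le_antisymm
    · refine le_iInf₂ fun S hS => ?_
      obtain ⟨hSX, hcov⟩ := hS
      have hex : ∃ ω, 0 < p ω := by
        by_contra! h
        have h1 : ∑ ω : Ω, p ω ≤ 0 := Finset.sum_nonpos fun ω _ => h ω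
        rw [hp.2] at h1
        linarith
      have hf : ∀ ω : Ω, ∃ A : Finset Ω, 0 < p ω → A ∈ S ∧ ω ∈ A := by
        intro ω
        by_cases h : 0 < p ω
        · obtain ⟨A, hA, hω⟩ := hcov ω h
          exact ⟨A, fun _ => ⟨hA, hω⟩⟩
        · exact ⟨∅, fun hh => absurd hh h⟩
      choose f hf using hf
      let g : Finset Ω → Finset Ω := fun A => A.filter fun ω => f ω = A
      let T : Finset (Finset Ω) := S.image g
      let Y : Finset (Finset Ω) := univ.filter fun C => ∃ A ∈ T, C ⊆ A
      have hTcov : ∀ ω : Ω, 0 < p ω → ∃ A ∈ T, ω ∈ A := by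
        intro ω h
        exact ⟨g (f ω), Finset.mem_image_of_mem g (hf ω h).1,
          Finset.mem_filter.2 ⟨(hf ω h).2, rfl⟩⟩
      have hTne : T.Nonempty := by
        obtain ⟨ω, h⟩ := hex
        obtain ⟨A, hA, _⟩ := hTcov ω h
        exact ⟨A, hA⟩
      have hYOI : IsOI Y := by
        refine ⟨T, hTne, ?_, fun C => by simp [Y]⟩
        intro A hA B hB hAB
        obtain ⟨A2, _, rfl⟩ := Finset.mem_image.1 hA
        obtain ⟨B2, _, rfl⟩ := Finset.mem_image.1 hB
        rw [Finset.disjoint_left]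
        intro ω h1 h2
        apply hAB
        rw [← (Finset.mem_filter.1 h1).2, ← (Finset.mem_filter.1 h2).2]
      have hYX : Y ⊆ X := by
        intro C hC
        obtain ⟨A, hA, hCA⟩ := (Finset.mem_filter.1 hC).2
        obtain ⟨A2, hA2, rfl⟩ := Finset.mem_image.1 hA
        exact hX.2 A2 (hSX hA2) C (hCA.trans (Finset.filter_subset _ _))
      have hTY : T ⊆ Y := fun A hA =>
        Finset.mem_filter.2 ⟨Finset.mem_univ _, A, hA, Finset.Subset.refl A⟩
      refine (iInf₂_le Y ⟨hYOI, hYX⟩).trans ((iInf₂_le T ⟨hTY, hTcov⟩).trans ?_)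
      apply ENNReal.ofReal_le_ofReal
      apply Real.logb_le_logb_of_le (by norm_num)
      · exact_mod_cast hTne.card_pos
      · exact_mod_cast Finset.card_image_le
    · refine le_iInf₂ fun Y hY => le_iInf₂ fun S hS => ?_
      exact iInf₂_le S ⟨hS.1.trans hY.2, hS.2⟩
  · apply le_antisymm
    · refine le_iInf₂ fun A hA => ?_
      have hOI : IsOI A.powerset ∧ A.powerset ⊆ X := by
        refine ⟨⟨{A}, by simp, ?_, by simp⟩, ?_⟩
        · intro B hB C hC hBC
          rw [Finset.mem_singleton] at hB hC
          exact absurd (hB.trans hC.symm) hBC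
        · intro B hB
          exact hX.2 A hA B (Finset.mem_powerset.1 hB)
      exact (iInf₂_le A.powerset hOI).trans
        (iInf₂_le A (Finset.mem_powerset.2 (Finset.Subset.refl A)))
    · refine le_iInf₂ fun Y hY => le_iInf₂ fun A hA => ?_
      exact iInf₂_le A (hY.2 hA)

end
end

section
/- Let X, Y be hyperconfusions over a finite probability space (Ω, p) with H(X) < ∞ and H(Y) < ∞. Then H(X ∩ Y) ≤ H(X) + H(Y) (equivalently, the mutual information I(X;Y) := H(X) + H(Y) − H(X∩Y) is nonnegative). Moreover, if X and Y are independent, then H(X ∩ Y) = H(X) + H(Y). -/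
open Finset
open scoped Classical ENNReal

noncomputable section

variable {Ω : Type*}

section Helpers

lemma aux_logb (x : ℝ) (hx : 0 < x) : Real.logb 2 x ≤ (x - 1) / Real.log 2 := by
  unfold Real.logb
  have h2 : 0 < Real.log 2 := Real.log_pos (by norm_num)
  gcongr
  exact Real.log_le_sub_one_of_pos hx

def QF [Fintype Ω] {ι : Type*} [Fintype ι] (q : ι → ℝ) (f : ι → Finset Ω) (z : Ω) : ℝ :=
  ∑ i, if z ∈ f i then q i else 0

def FF [Fintype Ω] {ι : Type*} [Fintype ι] (p : Ω → ℝ) (q : ι → ℝ) (f : ι → Finset Ω) : ℝ :=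
  ∑ z, p z * (- Real.logb 2 (QF q f z))

lemma QF_nonneg [Fintype Ω] {ι : Type*} [Fintype ι] (q : ι → ℝ) (f : ι → Finset Ω)
    (hq : ∀ i, 0 ≤ q i) (z : Ω) : 0 ≤ QF q f z := by
  unfold QF
  apply Finset.sum_nonneg
  intro i _
  split_ifs
  · exact hq i
  · exact le_rfl

lemma QF_le_one [Fintype Ω] {ι : Type*} [Fintype ι] (q : ι → ℝ) (f : ι → Finset Ω)
    (hq : ∀ i, 0 ≤ q i) (hs : ∑ i, q i = 1) (z : Ω) : QF q f z ≤ 1 := by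
  unfold QF
  rw [← hs]
  apply Finset.sum_le_sum
  intro i _
  split_ifs
  · exact le_rfl
  · exact hq i

lemma FF_nonneg [Fintype Ω] {ι : Type*} [Fintype ι] (p : Ω → ℝ) (hp : IsPMF p)
    (q : ι → ℝ) (f : ι → Finset Ω)
    (hq : ∀ i, 0 ≤ q i) (hs : ∑ i, q i = 1) : 0 ≤ FF p q f := by
  unfold FF
  apply Finset.sum_nonneg
  intro z _
  apply mul_nonneg (hp.1 z)
  rw [neg_nonneg]
  exact Real.logb_nonpos (by norm_num) (QF_nonneg q f hq z) (QF_le_one q f hq hs z)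

/-- Any mixture gives an upper bound for the entropy (basic version). -/
lemma Hent_le_base [Fintype Ω] (p : Ω → ℝ) (hp : IsPMF p) (X : Finset (Finset Ω))
    (q : Finset Ω → ℝ) (hq : ∀ i, 0 ≤ q i) (hs : ∑ i, q i = 1)
    (hX : ∀ i, q i ≠ 0 → i ∈ X) (hpos : ∀ z, 0 < p z → 0 < QF q id z) :
    Hent p X ≤ ENNReal.ofReal (FF p q id) := by
  have h2 : 0 < Real.log 2 := Real.log_pos (by norm_num)
  let k : Ω → Finset Ω → ℝ := fun z A =>
    if QF q id z = 0 then q A else (if z ∈ A then q A else 0) / QF q id z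
  have hQ0 := QF_nonneg q id hq
  have hk0 : ∀ z A, 0 ≤ k z A := by
    intro z A
    simp only [k]
    have := hq A
    have := hQ0 z
    split_ifs <;> positivity
  have hk1 : ∀ z, ∑ A : Finset Ω, k z A = 1 := by
    intro z
    simp only [k]
    split_ifs with h
    · exact hs
    · rw [← Finset.sum_div]
      exact div_self h
  have hkval : ValidK p X k := by
    refine ⟨hk0, hk1, ?_, ?_⟩
    · intro z A h
      apply hX
      intro h0
      simp [k, h0] at h
    · intro z A hz h
      by_contra hA
      simp [k, hA, (hpos z hz).ne'] at h
  refine (iInf₂_le k hkval).trans (ENNReal.ofReal_le_ofReal ?_)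
  set kb : Finset Ω → ℝ := fun A => ∑ z' : Ω, p z' * k z' A with hkb
  have hkb0 : ∀ A, 0 ≤ kb A := fun A => Finset.sum_nonneg fun z _ => mul_nonneg (hp.1 z) (hk0 z A)
  have key : ∀ z A, p z * k z A * Real.logb 2 (k z A / kb A) ≤
      p z * k z A * (- Real.logb 2 (QF q id z)) +
        (p z * k z A * (q A / kb A) - p z * k z A) / Real.log 2 := by
    intro z A
    rcases (mul_nonneg (hp.1 z) (hk0 z A)).eq_or_lt with h | h
    · rw [← h]; simp
    · have hz : 0 < p z := lt_of_le_of_ne (hp.1 z) (by rintro h'; simp [← h'] at h)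
      have hk : 0 < k z A := lt_of_le_of_ne (hk0 z A) (by rintro h'; simp [← h'] at h)
      have hQ := hpos z hz
      have hzA := hkval.2.2.2 z A hz hk
      have hkb : 0 < kb A := lt_of_lt_of_le h
        (Finset.single_le_sum (f := fun z => p z * k z A)
          (fun z _ => mul_nonneg (hp.1 z) (hk0 z A)) (Finset.mem_univ z))
      have hkq : k z A = q A / QF q id z := by simp [k, hzA, hQ.ne']
      have hqA : 0 < q A := lt_of_le_of_ne (hq A) (by rintro h'; simp [hkq, ← h'] at hk)
      have e : Real.logb 2 (k z A / kb A) =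
          - Real.logb 2 (QF q id z) + Real.logb 2 (q A / kb A) := by
        rw [hkq, Real.logb_div (by positivity) hkb.ne', Real.logb_div hqA.ne' hQ.ne',
          Real.logb_div hqA.ne' hkb.ne']
        ring
      have := aux_logb (q A / kb A) (by positivity)
      have := mul_le_mul_of_nonneg_left this h.le
      rw [e]
      calc _ = p z * k z A * (- Real.logb 2 (QF q id z)) +
            p z * k z A * Real.logb 2 (q A / kb A) := by ring
        _ ≤ _ := by
          gcongr
          refine this.trans (le_of_eq ?_)
          ring
  have tot : MI p k ≤ ∑ z, ∑ A, (p z * k z A * (- Real.logb 2 (QF q id z)) +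
        (p z * k z A * (q A / kb A) - p z * k z A) / Real.log 2) :=
    Finset.sum_le_sum fun z _ => Finset.sum_le_sum fun A _ => key z A
  refine tot.trans ?_
  simp only [Finset.sum_add_distrib]
  have e1 : ∑ z, ∑ A, p z * k z A * (- Real.logb 2 (QF q id z)) = FF p q id := by
    unfold FF
    refine Finset.sum_congr rfl fun z _ => ?_
    rw [← Finset.sum_mul, ← Finset.mul_sum, hk1, mul_one]
  have e2 : ∑ z, ∑ A, (p z * k z A * (q A / kb A) - p z * k z A) / Real.log 2 ≤ 0 := by
    simp only [← Finset.sum_div, Finset.sum_sub_distrib]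
    apply div_nonpos_of_nonpos_of_nonneg _ h2.le
    have a1 : ∑ z, ∑ A, p z * k z A = 1 := by
      simp only [← Finset.mul_sum, hk1, mul_one, hp.2]
    have a2 : ∑ z, ∑ A, p z * k z A * (q A / kb A) ≤ 1 := by
      rw [Finset.sum_comm, ← hs]
      refine Finset.sum_le_sum fun A _ => ?_
      rw [← Finset.sum_mul]
      change kb A * (q A / kb A) ≤ q A
      by_cases h : kb A = 0
      · simp [h, hq A]
      · rw [mul_div_cancel₀ _ h]
    linarith
  linarith

lemma Hent_le [Fintype Ω] {ι : Type*} [Fintype ι] (p : Ω → ℝ) (hp : IsPMF p)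
    (X : Finset (Finset Ω)) (q : ι → ℝ) (f : ι → Finset Ω)
    (hq : ∀ i, 0 ≤ q i) (hs : ∑ i, q i = 1)
    (hX : ∀ i, q i ≠ 0 → f i ∈ X) (hpos : ∀ z, 0 < p z → 0 < QF q f z) :
    Hent p X ≤ ENNReal.ofReal (FF p q f) := by
  let q' : Finset Ω → ℝ := fun A => ∑ i, if f i = A then q i else 0
  have hQ : ∀ z, QF q' id z = QF q f z := by
    intro z
    simp only [QF, q', id]
    have : ∀ A : Finset Ω, (if z ∈ A then ∑ i, (if f i = A then q i else 0) else 0) =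
        ∑ i, if f i = A then (if z ∈ f i then q i else 0) else 0 := by
      intro A
      split_ifs with h
      · refine Finset.sum_congr rfl fun i _ => ?_
        split_ifs with h1 h2
        · rfl
        · exact absurd (h1 ▸ h) h2
        · rfl
      · symm
        apply Finset.sum_eq_zero
        intro i _
        split_ifs with h1 h2
        · exact absurd (h1 ▸ h2) h
        · rfl
        · rfl
    simp only [this]
    rw [Finset.sum_comm]
    simp
  have hF : FF p q f = FF p q' id := by
    simp only [FF, hQ]
  rw [hF]
  apply Hent_le_base p hp X q'
  · intro A
    refine Finset.sum_nonneg fun i _ => ?_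
    split_ifs
    · exact hq i
    · exact le_rfl
  · simp only [q']
    rw [Finset.sum_comm]
    simpa using hs
  · intro A hA
    obtain ⟨i, _, hi⟩ := Finset.exists_ne_zero_of_sum_ne_zero hA
    split_ifs at hi with h
    · exact h ▸ hX i hi
    · exact absurd rfl hi
  · intro z hz
    rw [hQ]
    exact hpos z hz

/-- The marginal of a valid kernel gives a mixture with a smaller cost. -/
lemma exists_mixture [Fintype Ω] (p : Ω → ℝ) (hp : IsPMF p) (X : Finset (Finset Ω))
    (k : Ω → Finset Ω → ℝ) (hk : ValidK p X k) :
    ∃ q : Finset Ω → ℝ, (∀ i, 0 ≤ q i) ∧ (∑ i, q i = 1) ∧ (∀ i, q i ≠ 0 → i ∈ X) ∧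
      (∀ z, 0 < p z → 0 < QF q id z) ∧ FF p q id ≤ MI p k := by
  have h2 : 0 < Real.log 2 := Real.log_pos (by norm_num)
  obtain ⟨hk0, hk1, hkX, hkz⟩ := hk
  let q : Finset Ω → ℝ := fun A => ∑ z' : Ω, p z' * k z' A
  have hq0 : ∀ A, 0 ≤ q A := fun A => Finset.sum_nonneg fun z _ => mul_nonneg (hp.1 z) (hk0 z A)
  have hqpos : ∀ z A, 0 < p z → 0 < k z A → 0 < q A := fun z A hz h =>
    lt_of_lt_of_le (mul_pos hz h)
        (Finset.single_le_sum (f := fun z => p z * k z A)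
          (fun z _ => mul_nonneg (hp.1 z) (hk0 z A)) (Finset.mem_univ z))
  have hpos : ∀ z, 0 < p z → 0 < QF q id z := by
    intro z hz
    obtain ⟨A, _, hA⟩ := Finset.exists_ne_zero_of_sum_ne_zero
      (show ∑ A : Finset Ω, k z A ≠ 0 by rw [hk1]; norm_num)
    have hA : 0 < k z A := lt_of_le_of_ne (hk0 z A) hA.symm
    have hzA := hkz z A hz hA
    apply Finset.sum_pos'
    · intro i _
      split_ifs
      · exact hq0 i
      · exact le_rfl
    · exact ⟨A, Finset.mem_univ _, by simpa [hzA] using hqpos z A hz hA⟩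
  refine ⟨q, hq0, ?_, ?_, hpos, ?_⟩
  · simp only [q]
    rw [Finset.sum_comm]
    simp only [← Finset.mul_sum, hk1, mul_one, hp.2]
  · intro A hA
    obtain ⟨z, _, hz⟩ := Finset.exists_ne_zero_of_sum_ne_zero hA
    exact hkX z A (lt_of_le_of_ne (hk0 z A) (right_ne_zero_of_mul hz).symm)
  · refine Finset.sum_le_sum fun z _ => ?_
    simp only [mul_assoc, ← Finset.mul_sum]
    rcases (hp.1 z).eq_or_lt with hz | hz
    · simp [← hz]
    apply mul_le_mul_of_nonneg_left _ hz.le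
    have hQ := hpos z hz
    have key : ∀ A, k z A * (- Real.logb 2 (QF q id z)) -
        ((if z ∈ A then q A else 0) / QF q id z - k z A) / Real.log 2 ≤
        k z A * Real.logb 2 (k z A / q A) := by
      intro A
      rcases (hk0 z A).eq_or_lt with h | h
      · rw [← h]
        simp only [zero_mul, zero_sub, sub_zero, neg_nonpos]
        have := hq0 A
        split_ifs <;> positivity
      · have hzA := hkz z A hz h
        have hqA := hqpos z A hz h
        rw [if_pos hzA]
        have := aux_logb (q A / (k z A * QF q id z)) (by positivity)
        have := mul_le_mul_of_nonneg_left this h.le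
        rw [Real.logb_div hqA.ne' (by positivity), Real.logb_mul h.ne' hQ.ne'] at this
        rw [Real.logb_div h.ne' hqA.ne']
        have e : k z A * ((q A / (k z A * QF q id z) - 1) / Real.log 2) =
          (q A / QF q id z - k z A) / Real.log 2 := by field_simp
        rw [e] at this
        linarith
    refine le_trans (le_of_eq ?_) (Finset.sum_le_sum fun A _ => key A)
    simp only [Finset.sum_sub_distrib, ← Finset.sum_mul, ← Finset.sum_div, hk1]
    have : (∑ A : Finset Ω, if z ∈ A then q A else 0) = QF q id z := rfl
    rw [this, div_self hQ.ne']
    simp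

lemma subadd_part [Fintype Ω] (p : Ω → ℝ) (hp : IsPMF p)
    (X Y : Finset (Finset Ω)) (hX : IsHyp X) (hY : IsHyp Y) :
    Hent p (X ∩ Y) ≤ Hent p X + Hent p Y := by
  have : ∀ k, ValidK p X k → ∀ l, ValidK p Y l →
      Hent p (X ∩ Y) ≤ ENNReal.ofReal (MI p k) + ENNReal.ofReal (MI p l) := by
    intro k hk l hl
    obtain ⟨q, q0, q1, qX, qpos, qF⟩ := exists_mixture p hp X k hk
    obtain ⟨r, r0, r1, rY, rpos, rF⟩ := exists_mixture p hp Y l hl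
    have hQ : ∀ z, QF (fun i : Finset Ω × Finset Ω => q i.1 * r i.2) (fun i => i.1 ∩ i.2) z =
        QF q id z * QF r id z := by
      intro z
      simp only [QF, id]
      rw [Finset.sum_mul_sum, Fintype.sum_prod_type]
      refine Finset.sum_congr rfl fun A _ => Finset.sum_congr rfl fun B _ => ?_
      by_cases h1 : z ∈ A <;> by_cases h2 : z ∈ B <;> simp [h1, h2]
    have := Hent_le p hp (X ∩ Y) (fun i : Finset Ω × Finset Ω => q i.1 * r i.2)
      (fun i => i.1 ∩ i.2) (fun i => mul_nonneg (q0 _) (r0 _))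
      (by rw [Fintype.sum_prod_type, ← Finset.sum_mul_sum, q1, r1, one_mul])
      (fun i hi => Finset.mem_inter.2
        ⟨hX.2 _ (qX _ (left_ne_zero_of_mul hi)) _ Finset.inter_subset_left,
          hY.2 _ (rY _ (right_ne_zero_of_mul hi)) _ Finset.inter_subset_right⟩)
      (fun z hz => by rw [hQ]; exact mul_pos (qpos z hz) (rpos z hz))
    have hF : FF p (fun i : Finset Ω × Finset Ω => q i.1 * r i.2) (fun i => i.1 ∩ i.2) =
        FF p q id + FF p r id := by
      simp only [FF]
      rw [← Finset.sum_add_distrib]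
      refine Finset.sum_congr rfl fun z _ => ?_
      rcases (hp.1 z).eq_or_lt with hz | hz
      · simp [← hz]
      · rw [hQ, Real.logb_mul (qpos z hz).ne' (rpos z hz).ne']
        ring
    rw [hF] at this
    refine this.trans (ENNReal.ofReal_add_le.trans ?_)
    gcongr
  conv_rhs => unfold Hent
  simp only [ENNReal.iInf_add, ENNReal.add_iInf]
  simp only [le_iInf_iff]
  intros
  apply this <;> assumption

lemma mobius_zero [Fintype Ω] {α : Type*} (c : Ω → ℝ) (u : Ω → Finset α)
    (h : ∀ s, ∑ z, (if u z ⊆ s then c z else 0) = 0) (s : Finset α) :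
    ∑ z, (if u z = s then c z else 0) = 0 := by
  induction s using Finset.strongInduction with
  | H s ih =>
    have e : ∀ z, (if u z ⊆ s then c z else 0) =
        (if u z = s then c z else 0) + ∑ t ∈ s.ssubsets, if u z = t then c z else 0 := by
      intro z
      rw [Finset.sum_ite_eq]
      by_cases h1 : u z = s
      · simp [h1]
      · simp [h1, Finset.ssubset_iff_subset_ne]
    have := h s
    simp only [e, Finset.sum_add_distrib] at this
    rw [Finset.sum_comm, Finset.sum_eq_zero (s := s.ssubsets)
      (fun t ht => ih t (Finset.mem_ssubsets.1 ht)), add_zero] at this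
    exact this

lemma mobius_fun [Fintype Ω] {α : Type*} (c : Ω → ℝ) (u : Ω → Finset α)
    (h : ∀ s, ∑ z, (if u z ⊆ s then c z else 0) = 0) (g : Finset α → ℝ) :
    ∑ z, c z * g (u z) = 0 := by
  have e : ∀ z, c z * g (u z) =
      ∑ s ∈ Finset.univ.image u, g s * (if u z = s then c z else 0) := by
    intro z
    simp [mul_comm]
  simp only [e]
  rw [Finset.sum_comm]
  refine Finset.sum_eq_zero fun s _ => ?_
  rw [← Finset.mul_sum, mobius_zero c u h, mul_zero]

lemma indep_prod [Fintype Ω] {α : Type*} (p : Ω → ℝ) (hp : IsPMF p) (u v : Ω → Finset α)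
    (h : ∀ s t, ∑ z, (if u z ⊆ s ∧ v z ⊆ t then p z else 0) =
      (∑ z, if u z ⊆ s then p z else 0) * (∑ z, if v z ⊆ t then p z else 0))
    (f g : Finset α → ℝ) :
    ∑ z, p z * (f (u z) * g (v z)) = (∑ z, p z * f (u z)) * (∑ z, p z * g (v z)) := by
  have st1 : ∀ t, ∑ z, (p z * ((if v z ⊆ t then 1 else 0) -
      ∑ w, if v w ⊆ t then p w else 0)) * f (u z) = 0 := by
    intro t
    apply mobius_fun
    intro s
    have e : ∀ z, (if u z ⊆ s then (p z * ((if v z ⊆ t then 1 else 0) -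
      ∑ w, if v w ⊆ t then p w else 0)) else 0) = (if u z ⊆ s ∧ v z ⊆ t then p z else 0) -
        (if u z ⊆ s then p z else 0) * ∑ w, if v w ⊆ t then p w else 0 := by
      intro z
      by_cases h1 : u z ⊆ s <;> by_cases h2 : v z ⊆ t <;> simp [h1, h2] <;> ring
    simp only [e, Finset.sum_sub_distrib, ← Finset.sum_mul]
    rw [h, sub_self]
  have st2 : ∑ z, (p z * (f (u z) - ∑ w, p w * f (u w))) * g (v z) = 0 := by
    apply mobius_fun
    intro t
    have e1 : ∀ z, (p z * ((if v z ⊆ t then 1 else 0) -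
      ∑ w, if v w ⊆ t then p w else 0)) * f (u z) =
        (if v z ⊆ t then p z * f (u z) else 0) -
          (∑ w, if v w ⊆ t then p w else 0) * (p z * f (u z)) := by
      intro z
      by_cases h2 : v z ⊆ t <;> simp [h2] <;> ring
    have e2 : ∀ z, (if v z ⊆ t then p z * (f (u z) - ∑ w, p w * f (u w)) else 0) =
        (if v z ⊆ t then p z * f (u z) else 0) -
          (if v z ⊆ t then p z else 0) * ∑ w, p w * f (u w) := by
      intro z
      by_cases h2 : v z ⊆ t <;> simp [h2] <;> ring
    have := st1 t
    simp only [e1, Finset.sum_sub_distrib, ← Finset.mul_sum] at this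
    simp only [e2, Finset.sum_sub_distrib, ← Finset.sum_mul]
    exact this
  have e : ∀ z, (p z * (f (u z) - ∑ w, p w * f (u w))) * g (v z) =
      p z * (f (u z) * g (v z)) - (∑ w, p w * f (u w)) * (p z * g (v z)) := by
    intro z; ring
  simp only [e, Finset.sum_sub_distrib, ← Finset.mul_sum] at st2
  linarith

lemma indep_fun [Fintype Ω] {α : Type*} (p : Ω → ℝ) (hp : IsPMF p) (u v : Ω → Finset α)
    (h : ∀ s t, ∑ z, (if u z ⊆ s ∧ v z ⊆ t then p z else 0) =
      (∑ z, if u z ⊆ s then p z else 0) * (∑ z, if v z ⊆ t then p z else 0))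
    (G : Finset α → Finset α → ℝ) :
    ∑ z, p z * G (u z) (v z) = ∑ z, ∑ w, p z * (p w * G (u z) (v w)) := by
  have e : ∀ z w, G (u z) (v w) = ∑ s ∈ Finset.univ.image u,
      (if u z = s then 1 else 0) * G s (v w) := by
    intro z w
    simp
  calc _ = ∑ s ∈ Finset.univ.image u, ∑ z, p z * ((if u z = s then 1 else 0) * G s (v z)) := by
        rw [Finset.sum_comm]
        refine Finset.sum_congr rfl fun z _ => ?_
        rw [e z z, Finset.mul_sum]
    _ = ∑ s ∈ Finset.univ.image u, ∑ z, ∑ w,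
          p z * (p w * ((if u z = s then 1 else 0) * G s (v w))) := by
        refine Finset.sum_congr rfl fun s _ => ?_
        rw [indep_prod p hp u v h (fun x => if x = s then 1 else 0) (fun x => G s x),
          Finset.sum_mul_sum]
        refine Finset.sum_congr rfl fun z _ => Finset.sum_congr rfl fun w _ => ?_
        ring
    _ = _ := by
        rw [Finset.sum_comm]
        refine Finset.sum_congr rfl fun z _ => ?_
        rw [Finset.sum_comm]
        refine Finset.sum_congr rfl fun w _ => ?_
        rw [e z w, Finset.mul_sum, Finset.mul_sum]

lemma exists_max (X : Finset (Finset Ω)) (C : Finset Ω) :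
    ∃ M : Finset Ω, C ∈ X → (C ⊆ M ∧ M ∈ maxsHyp X) := by
  by_cases h : C ∈ X
  · obtain ⟨M, hCM, hM⟩ := Finset.exists_le_maximal X h
    refine ⟨M, fun _ => ⟨hCM, ?_⟩⟩
    unfold maxsHyp
    rw [Finset.mem_filter]
    exact ⟨hM.1, fun B hB hMB => subset_antisymm (hM.2 hB hMB) hMB⟩
  · exact ⟨C, fun h' => absurd h' h⟩

lemma maxs_mem (Z : Finset (Finset Ω)) (A : Finset Ω) (h : A ∈ maxsHyp Z) : A ∈ Z := by
  unfold maxsHyp at h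
  exact (Finset.mem_filter.1 h).1

def uu (X : Finset (Finset Ω)) (z : Ω) : Finset (Finset Ω) := (maxsHyp X).filter fun A => z ∈ A

lemma uu_subset (X s : Finset (Finset Ω)) (z : Ω) :
    uu X z ⊆ s ↔ ¬ z ∈ (maxsHyp X \ s).biUnion id := by
  simp only [uu, Finset.subset_iff, Finset.mem_filter, Finset.mem_biUnion, Finset.mem_sdiff, id]
  grind

lemma uu_indep [Fintype Ω] (p : Ω → ℝ) (hp : IsPMF p) (X Y : Finset (Finset Ω))
    (hI : IndepHyp p X Y) (s t : Finset (Finset Ω)) :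
    ∑ z, (if uu X z ⊆ s ∧ uu Y z ⊆ t then p z else 0) =
      (∑ z, if uu X z ⊆ s then p z else 0) * (∑ z, if uu Y z ⊆ t then p z else 0) := by
  have := hI (maxsHyp X \ s) Finset.sdiff_subset (maxsHyp Y \ t) Finset.sdiff_subset
  simp only [uu_subset]
  generalize (maxsHyp X \ s).biUnion id = U at *
  generalize (maxsHyp Y \ t).biUnion id = V at *
  have hps : ∀ A : Finset Ω, pset p A = ∑ z, if z ∈ A then p z else 0 := by
    intro A
    simp [pset]
  have hc : ∀ A : Finset Ω, (∑ z, if ¬ z ∈ A then p z else 0) = 1 - pset p A := by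
    intro A
    rw [hps, ← hp.2, ← Finset.sum_sub_distrib]
    refine Finset.sum_congr rfl fun z _ => ?_
    by_cases h : z ∈ A <;> simp [h]
  have hcc : (∑ z, if ¬ z ∈ U ∧ ¬ z ∈ V then p z else 0) =
      1 - pset p U - pset p V + pset p (U ∩ V) := by
    rw [hps, hps, hps, ← hp.2, ← Finset.sum_sub_distrib, ← Finset.sum_sub_distrib,
      ← Finset.sum_add_distrib]
    refine Finset.sum_congr rfl fun z _ => ?_
    by_cases h : z ∈ U <;> by_cases h' : z ∈ V <;> simp [h, h']
  rw [hc, hc, hcc, this]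
  ring

lemma indep_part [Fintype Ω] (p : Ω → ℝ) (hp : IsPMF p)
    (X Y : Finset (Finset Ω)) (hfX : Hent p X < ⊤) (hfY : Hent p Y < ⊤)
    (hI : IndepHyp p X Y) : Hent p X + Hent p Y ≤ Hent p (X ∩ Y) := by
  refine le_iInf₂ fun k hk => ?_
  obtain ⟨q, q0, q1, qXY, qpos, qF⟩ := exists_mixture p hp (X ∩ Y) k hk
  have qX : ∀ i, q i ≠ 0 → i ∈ X := fun i hi => (Finset.mem_inter.1 (qXY i hi)).1
  have qY : ∀ i, q i ≠ 0 → i ∈ Y := fun i hi => (Finset.mem_inter.1 (qXY i hi)).2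
  choose mX hmX using exists_max X
  choose mY hmY using exists_max Y
  have hind := indep_fun p hp (uu X) (uu Y) (fun s t => by convert uu_indep p hp X Y hI s t)
  let R : Finset (Finset Ω) → Finset (Finset Ω) → ℝ := fun s t =>
    ∑ C, if mX C ∈ s ∧ mY C ∈ t then q C else 0
  have hR : ∀ z w, R (uu X z) (uu Y w) = ∑ C, if z ∈ mX C ∧ w ∈ mY C then q C else 0 := by
    intro z w
    refine Finset.sum_congr rfl fun C _ => ?_
    by_cases hC : q C = 0
    · simp [hC]
    · simp [uu, (hmX C (qX C hC)).2, (hmY C (qY C hC)).2]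
  have hRnn : ∀ s t, 0 ≤ R s t := by
    intro s t
    refine Finset.sum_nonneg fun C _ => ?_
    split_ifs
    · exact q0 C
    · exact le_rfl
  have hQR : ∀ z, QF q id z ≤ R (uu X z) (uu Y z) := by
    intro z
    rw [hR]
    refine Finset.sum_le_sum fun C _ => ?_
    by_cases hC : q C = 0
    · simp [hC]
    · by_cases hz : z ∈ C
      · simp [hz, (hmX C (qX C hC)).1 hz, (hmY C (qY C hC)).1 hz]
      · simp only [id, hz, if_false]
        split_ifs
        · exact q0 C
        · exact le_rfl
  -- positivity off the diagonal
  have hRpos : ∀ z w, 0 < p z → 0 < p w → 0 < R (uu X z) (uu Y w) := by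
    intro z w hz hw
    by_contra hcon
    have h0 : R (uu X z) (uu Y w) = 0 := le_antisymm (not_lt.1 hcon) (hRnn _ _)
    have := hind (fun s t => if R s t = 0 then 1 else 0)
    have hl : ∑ z, p z * (if R (uu X z) (uu Y z) = 0 then (1:ℝ) else 0) = 0 := by
      refine Finset.sum_eq_zero fun z _ => ?_
      rcases (hp.1 z).eq_or_lt with hz | hz
      · simp [← hz]
      · rw [if_neg ((qpos z hz).trans_le (hQR z)).ne', mul_zero]
    rw [hl] at this
    have nn : ∀ z w, 0 ≤ p z * (p w * (if R (uu X z) (uu Y w) = 0 then (1:ℝ) else 0)) := by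
      intro z w
      have := hp.1 z
      have := hp.1 w
      split_ifs <;> positivity
    have h1 := (Finset.sum_eq_zero_iff_of_nonneg
      (fun z _ => Finset.sum_nonneg fun w _ => nn z w)).1 this.symm z (Finset.mem_univ _)
    have h2 := (Finset.sum_eq_zero_iff_of_nonneg (fun w _ => nn z w)).1 h1 w (Finset.mem_univ _)
    rw [if_pos h0] at h2
    have : 0 < p z * (p w * 1) := by positivity
    linarith
  have hF1 : ∑ z, p z * (- Real.logb 2 (R (uu X z) (uu Y z))) ≤ FF p q id := by
    refine Finset.sum_le_sum fun z _ => ?_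
    rcases (hp.1 z).eq_or_lt with hz | hz
    · simp [← hz]
    · apply mul_le_mul_of_nonneg_left _ hz.le
      rw [neg_le_neg_iff]
      exact Real.logb_le_logb_of_le (by norm_num) (qpos z hz) (hQR z)
  rw [hind (fun s t => - Real.logb 2 (R s t))] at hF1
  -- first marginal
  have hQ1R : ∀ z w, R (uu X z) (uu Y w) ≤ QF q mX z := by
    intro z w
    rw [hR]
    refine Finset.sum_le_sum fun C _ => ?_
    have := q0 C
    by_cases h1 : z ∈ mX C <;> by_cases h2 : w ∈ mY C <;> simp [h1, h2, this]
  have hQ1 : ∀ z, 0 < p z → 0 < QF q mX z := fun z hz => (hRpos z z hz hz).trans_le (hQ1R z z)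
  have maxmem : ∀ (Z : Finset (Finset Ω)) A, A ∈ maxsHyp Z → A ∈ Z := fun Z A h =>
    maxs_mem Z A h
  have bX : (Hent p X).toReal ≤ FF p q mX := by
    refine ENNReal.toReal_le_of_le_ofReal (FF_nonneg p hp q mX q0 q1) ?_
    exact Hent_le p hp X q mX q0 q1 (fun i hi => maxmem _ _ (hmX i (qX i hi)).2) hQ1
  have bY : ∀ z, 0 < p z → (Hent p Y).toReal ≤
      ∑ w, p w * (- Real.logb 2 (R (uu X z) (uu Y w) / QF q mX z)) := by
    intro z hz
    let r : Finset Ω → ℝ := fun C => (if z ∈ mX C then q C else 0) / QF q mX z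
    have hQz := hQ1 z hz
    have r0 : ∀ i, 0 ≤ r i := by
      intro i
      have := q0 i
      simp only [r]
      split_ifs <;> positivity
    have r1 : ∑ i, r i = 1 := by
      simp only [r]
      rw [← Finset.sum_div]
      exact div_self hQz.ne'
    have hrQ : ∀ w, QF r mY w = R (uu X z) (uu Y w) / QF q mX z := by
      intro w
      rw [hR, Finset.sum_div]
      refine Finset.sum_congr rfl fun C _ => ?_
      by_cases h1 : z ∈ mX C <;> by_cases h2 : w ∈ mY C <;> simp [r, h1, h2]
    have hFr : FF p r mY = ∑ w, p w * (- Real.logb 2 (R (uu X z) (uu Y w) / QF q mX z)) := by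
      simp only [FF, hrQ]
    rw [← hFr]
    refine ENNReal.toReal_le_of_le_ofReal (FF_nonneg p hp r mY r0 r1) ?_
    refine Hent_le p hp Y r mY r0 r1 (fun i hi => maxmem _ _ (hmY i (qY i ?_)).2) ?_
    · intro h
      simp [r, h] at hi
    · intro w hw
      rw [hrQ]
      exact div_pos (hRpos z w hz hw) hQz
  have hsum : (Hent p X).toReal + (Hent p Y).toReal ≤
      ∑ z, ∑ w, p z * (p w * (- Real.logb 2 (R (uu X z) (uu Y w)))) := by
    calc _ ≤ FF p q mX + ∑ z, p z * (Hent p Y).toReal := by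
          rw [← Finset.sum_mul, hp.2, one_mul]
          linarith
      _ ≤ ∑ z, p z * (- Real.logb 2 (QF q mX z) +
            ∑ w, p w * (- Real.logb 2 (R (uu X z) (uu Y w) / QF q mX z))) := by
          simp only [FF]
          rw [← Finset.sum_add_distrib]
          refine Finset.sum_le_sum fun z _ => ?_
          rcases (hp.1 z).eq_or_lt with hz | hz
          · simp [← hz]
          · rw [← mul_add]
            apply mul_le_mul_of_nonneg_left _ hz.le
            have := bY z hz
            linarith
      _ = _ := by
          refine Finset.sum_congr rfl fun z _ => ?_
          rw [← Finset.mul_sum]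
          rcases (hp.1 z).eq_or_lt with hz | hz
          · simp [← hz]
          congr 1
          have : - Real.logb 2 (QF q mX z) = ∑ w, p w * (- Real.logb 2 (QF q mX z)) := by
            rw [← Finset.sum_mul, hp.2, one_mul]
          rw [this, ← Finset.sum_add_distrib]
          refine Finset.sum_congr rfl fun w _ => ?_
          rcases (hp.1 w).eq_or_lt with hw | hw
          · simp [← hw]
          rw [Real.logb_div (hRpos z w hz hw).ne' (hQ1 z hz).ne']
          ring
  rw [← ENNReal.ofReal_toReal hfX.ne, ← ENNReal.ofReal_toReal hfY.ne,
    ← ENNReal.ofReal_add ENNReal.toReal_nonneg ENNReal.toReal_nonneg]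
  apply ENNReal.ofReal_le_ofReal
  linarith

end Helpers

/-- Subadditivity `H(X ∩ Y) ≤ H(X) + H(Y)` (nonnegativity of mutual
information), with equality when `X` and `Y` are independent. -/
theorem stmt9 [Fintype Ω] (p : Ω → ℝ) (hp : IsPMF p)
    (X Y : Finset (Finset Ω)) (hX : IsHyp X) (hY : IsHyp Y)
    (hfX : Hent p X < ⊤) (hfY : Hent p Y < ⊤) :
    Hent p (X ∩ Y) ≤ Hent p X + Hent p Y ∧
    (IndepHyp p X Y → Hent p (X ∩ Y) = Hent p X + Hent p Y) := by
  refine ⟨subadd_part p hp X Y hX hY, fun hI => ?_⟩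
  exact le_antisymm (subadd_part p hp X Y hX hY) (indep_part p hp X Y hfX hfY hI)

end
end
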